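/- arXiv:2204.01317 — 3 statements merged into one kernel-verified Lean document; each statement's English description precedes it below -/
import Mathlib

section
/- Suppose P̄ contains at least one complete, non-graded subset. Then the Krull dimension of R(P)/tr(ω) (i.e. the dimension of the non-Gorenstein locus of the Hibi ring R(P)) equals the maximum of #P − #A + 2, where A runs over all complete, non-graded subsets of P̄. -/
noncomputable section

/-- `ψ : Q → ℤ` is a grading of the poset `Q`: it drops by exactly one along every covering
relation (functions here are order-reversing, matching the conventions for Hibi rings). -/
def IsGrading (Q : Type*) [PartialOrder Q] (ψ : Q → ℤ) : Prop :=
  ∀ a b : Q, a ⋖ b → ψ a = ψ b + 1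

/-- a poset is graded if it admits a grading -/
def IsGradedPoset (Q : Type*) [PartialOrder Q] : Prop :=
  ∃ ψ : Q → ℤ, IsGrading Q ψ

/-- a subset `A` of a poset is connected: any two of its elements are joined by a finite
sequence inside `A` in which consecutive elements are comparable -/
def ConnSubset {Q : Type*} [PartialOrder Q] (A : Set Q) : Prop :=
  ∀ x ∈ A, ∀ y ∈ A,
    Relation.ReflTransGen (fun p q : Q => p ∈ A ∧ q ∈ A ∧ (p ≤ q ∨ q ≤ p)) x y

/-- a subset `A` of a poset is order-convex: `a ≤ b ≤ c` with `a, c ∈ A` implies `b ∈ A` -/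
def OrderConvex {Q : Type*} [PartialOrder Q] (A : Set Q) : Prop :=
  ∀ a b c : Q, a ≤ b → b ≤ c → a ∈ A → c ∈ A → b ∈ A

/-- a complete subset: nonempty, connected and order-convex (exactly the subsets occurring as
fibres of quotient poset maps) -/
def CompleteSubset {Q : Type*} [PartialOrder Q] (A : Set Q) : Prop :=
  A.Nonempty ∧ ConnSubset A ∧ OrderConvex A

/-- `φ : Q → Q'` is a quotient poset map: surjective, order preserving, with connected fibres,
such that the order on `Q'` is the transitive closure of the relation
`a' ≤ b' ↔ ∃ a ∈ φ⁻¹(a'), b ∈ φ⁻¹(b'), a ≤ b`. -/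
def IsQuotientPosetMap {Q Q' : Type*} [PartialOrder Q] [PartialOrder Q']
    (φ : Q → Q') : Prop :=
  Function.Surjective φ ∧ Monotone φ ∧ (∀ q' : Q', ConnSubset (φ ⁻¹' {q'})) ∧
    ∀ a' b' : Q', a' ≤ b' ↔
      Relation.TransGen (fun x' y' : Q' => ∃ a b : Q, φ a = x' ∧ φ b = y' ∧ a ≤ b) a' b'


set_option synthInstance.maxHeartbeats 1000000
set_option maxHeartbeats 1000000

/-- `P̄ = P ∪ {-∞, ∞}`: the poset `P` with a new minimum and a new maximum adjoined -/
abbrev Pbar (P : Type) [PartialOrder P] : Type := WithBot (WithTop P)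

variable (k : Type) [Field k] (P : Type) [Fintype P] [PartialOrder P]

/-- the monomial `χ^ψ` in the Laurent polynomial ring -/
def hibiMono (ψ : Pbar P → ℤ) : AddMonoidAlgebra k (Pbar P → ℤ) :=
  AddMonoidAlgebra.single ψ 1

/-- a lattice point of the cone `C(P)`: an order-reversing integral function on `P̄`
with `ψ(∞) = 0` -/
def InConeP (ψ : Pbar P → ℤ) : Prop := Antitone ψ ∧ ψ ⊤ = 0

/-- the Hibi ring `R(P) = k[C(P) ∩ ℤ^{P ∪ {-∞}}]`, the subalgebra of the Laurent polynomial
ring spanned by the monomials `χ^ψ` with `ψ` an integral point of `C(P)` -/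
def hibiRing : Subalgebra k (AddMonoidAlgebra k (Pbar P → ℤ)) :=
  Algebra.adjoin k {f | ∃ ψ : Pbar P → ℤ, InConeP P ψ ∧ f = hibiMono k P ψ}

/-- the canonical module `ω` of the Hibi ring: spanned by the monomials `χ^ψ` with `ψ`
integral, `ψ(∞) = 0` and `ψ a ≥ ψ b + 1` for every covering relation `a ⋖ b` of `P̄` -/
def hibiOmega : Submodule ↥(hibiRing k P) (AddMonoidAlgebra k (Pbar P → ℤ)) :=
  Submodule.span ↥(hibiRing k P)
    {f | ∃ ψ : Pbar P → ℤ, ψ ⊤ = 0 ∧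
      (∀ a b : Pbar P, a ⋖ b → ψ b + 1 ≤ ψ a) ∧ f = hibiMono k P ψ}

/-- the trace ideal `tr(ω)` of the canonical module of the Hibi ring -/
def hibiTrace : Ideal ↥(hibiRing k P) :=
  Ideal.span {r | ∃ (φ : ↥(hibiOmega k P) →ₗ[↥(hibiRing k P)] ↥(hibiRing k P))
    (x : ↥(hibiOmega k P)), φ x = r}

end

/-- The length of a chain of primes starting at `p 0` is bounded by the transcendence degree of the
quotient by `p 0`. -/
theorem exists_algebraicIndependent_of_strictMono {k R : Type*} [Field k] [CommRing R] [Algebra k R]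
    (n : ℕ) (p : Fin (n + 1) → PrimeSpectrum R) (hp : StrictMono p) :
    ∃ x : Fin n → R ⧸ (p 0).asIdeal, AlgebraicIndependent k x := by
  induction n with
  | zero =>
    refine ⟨Fin.elim0, ?_⟩
    rw [algebraicIndependent_empty_type_iff]
    exact (algebraMap k (R ⧸ (p 0).asIdeal)).injective
  | succ n ih =>
    obtain ⟨x, hx⟩ := ih (fun i => p i.succ) (fun i j h => hp (Fin.succ_lt_succ_iff.mpr h))
    have h01 : (p 0).asIdeal < (p (Fin.succ 0)).asIdeal := hp (Fin.succ_pos 0)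
    obtain ⟨y, hy1, hy0⟩ := Set.exists_of_ssubset h01
    let f := Ideal.Quotient.factorₐ k h01.le
    have hf : Function.Surjective f := Ideal.Quotient.factor_surjective h01.le
    choose z hz using fun i => hf (x i)
    have hfz : AlgebraicIndependent k (f ∘ z) := by
      convert hx using 1
      exact funext hz
    have hzi : AlgebraicIndependent k z := hfz.of_comp f
    have htr : Transcendental (Algebra.adjoin k (Set.range z))
        (Ideal.Quotient.mk (p 0).asIdeal y) := by
      intro halg
      have hy : Ideal.Quotient.mk (p 0).asIdeal y ≠ 0 := by
        rwa [Ne, Ideal.Quotient.eq_zero_iff_mem]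
      obtain ⟨q, hq0, hq⟩ := halg.exists_nonzero_coeff_and_aeval_eq_zero
        (mem_nonZeroDivisors_of_ne_zero hy)
      apply hq0
      have hfq : f (q.coeff 0 : R ⧸ (p 0).asIdeal) = 0 := by
        rw [← Polynomial.divX_mul_X_add q] at hq
        simp only [map_add, map_mul, Polynomial.aeval_X, Polynomial.aeval_C] at hq
        have := congrArg f hq
        rw [map_add, map_mul, map_zero] at this
        have hfy : f (Ideal.Quotient.mk (p 0).asIdeal y) = 0 :=
          Ideal.Quotient.eq_zero_iff_mem.mpr hy1
        rw [hfy, mul_zero, zero_add] at this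
        simpa using this
      obtain ⟨Q, hQ⟩ : ∃ Q : MvPolynomial (Fin n) k,
          MvPolynomial.aeval z Q = (q.coeff 0 : R ⧸ (p 0).asIdeal) := by
        have h := Algebra.adjoin_range_eq_range_aeval k z
        exact h.le (q.coeff 0).2
      have h0 : MvPolynomial.aeval (f ∘ z) Q = 0 := by
        rw [← hfq, ← hQ, MvPolynomial.comp_aeval_apply]
        rfl
      have : Q = 0 := (map_eq_zero_iff _ hfz).mp h0
      apply Subtype.ext
      rw [← hQ, this, map_zero]
      rfl
    have := (AlgebraicIndependent.option_iff_transcendental hzi _).mpr htr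
    exact ⟨_, (algebraicIndependent_equiv (finSuccEquiv n)).mpr this⟩

theorem linearIndependent_int_of_nat {ι V : Type*} [AddCommGroup V] (v : ι → V)
    (hv : LinearIndependent ℕ v) : LinearIndependent ℤ v := by
  rw [linearIndependent_iff]
  intro z hz
  have key : Finsupp.linearCombination ℕ v (z.mapRange Int.toNat rfl) =
      Finsupp.linearCombination ℕ v (z.mapRange (fun a => Int.toNat (-a)) rfl) := by
    rw [← sub_eq_zero, ← hz]
    simp only [Finsupp.linearCombination_apply]
    rw [Finsupp.sum_mapRange_index (by simp), Finsupp.sum_mapRange_index (by simp),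
      ← Finsupp.sum_sub]
    refine Finsupp.sum_congr fun i _ => ?_
    rw [← natCast_zsmul, ← natCast_zsmul, ← sub_smul]
    congr 1
    omega
  ext i
  have := DFunLike.congr_fun (hv key) i
  simp only [Finsupp.mapRange_apply] at this
  simp only [Finsupp.coe_zero, Pi.zero_apply]
  omega

/-- An algebra generated by monomials with exponents in a submonoid of `ℤ ^ τ` has transcendence
degree at most `#τ`. -/
theorem trdeg_le_card_of_monomials {k A S τ : Type} [Field k] [CommRing A] [IsDomain A]
    [Algebra k A] [AddCommMonoid S] [Fintype τ] (χ : Multiplicative S →* A)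
    (hχ : Algebra.adjoin k (Set.range χ) = ⊤) (e : S →+ (τ → ℤ)) (he : Function.Injective e) :
    Algebra.trdeg k A ≤ Fintype.card τ := by
  have : Algebra.IsAlgebraic (Algebra.adjoin k (Set.range χ)) A := by
    refine ⟨fun a => ?_⟩
    exact isAlgebraic_algebraMap (⟨a, hχ ▸ Algebra.mem_top⟩ : Algebra.adjoin k (Set.range χ))
  obtain ⟨t, hts, ht⟩ := exists_isTranscendenceBasis_subset (R := k) (Set.range χ)
  choose s hs using fun i : t => hts i.2
  have hli : LinearIndependent ℕ (fun i => (s i).toAdd) := by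
    intro m m' hmm
    have aux (m : t →₀ ℕ) : χ (Multiplicative.ofAdd
        (Finsupp.linearCombination ℕ (fun i => (s i).toAdd) m)) =
        MvPolynomial.aeval (R := k) ((↑) : t → A) (MvPolynomial.monomial m 1) := by
      rw [MvPolynomial.aeval_monomial, map_one, one_mul, Finsupp.linearCombination_apply,
        Finsupp.sum, ofAdd_sum, map_prod, Finsupp.prod]
      refine Finset.prod_congr rfl fun i _ => ?_
      rw [ofAdd_nsmul, map_pow, ofAdd_toAdd, hs]
    have h := ht.1 ((aux m).symm.trans ((congrArg (fun a => χ (Multiplicative.ofAdd a)) hmm).trans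
      (aux m')))
    exact MvPolynomial.monomial_left_injective one_ne_zero h
  have hli' : LinearIndependent ℕ (fun i => e (s i).toAdd) :=
    hli.map_injOn e.toNatLinearMap he.injOn
  have := (linearIndependent_int_of_nat _ hli').cardinal_le_rank
  rw [rank_fun'] at this
  rwa [← ht.cardinalMk_eq_trdeg]

section PosetLemmas

variable {Q : Type*} [PartialOrder Q]

theorem le_iff_reflTransGen_covBy_of_finite [Finite Q] {a b : Q} :
    a ≤ b ↔ Relation.ReflTransGen (· ⋖ ·) a b := by
  classical
  have := Fintype.ofFinite Q
  let _ : LocallyFiniteOrder Q := Fintype.toLocallyFiniteOrder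
  exact le_iff_reflTransGen_covBy

theorem antitone_of_forall_covBy [Finite Q] {ψ : Q → ℤ} (h : ∀ a b, a ⋖ b → ψ b ≤ ψ a) :
    Antitone ψ := by
  intro a b hab
  induction le_iff_reflTransGen_covBy_of_finite.mp hab with
  | refl => exact le_rfl
  | tail h₁ h₂ ih => exact (h _ _ h₂).trans (ih (le_iff_reflTransGen_covBy_of_finite.mpr h₁))

theorem OrderConvex.covBy_of_covBy {A : Set Q} (hA : OrderConvex A) {a b : A} (h : a ⋖ b) :
    (a : Q) ⋖ b :=
  ⟨h.1, fun c hac hcb => h.2 (c := ⟨c, hA a c b hac.le hcb.le a.2 b.2⟩) hac hcb⟩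

theorem exists_strictAnti_natural (Q : Type*) [PartialOrder Q] [Finite Q] :
    ∃ (h : Q → ℤ) (K : ℤ), StrictAnti h ∧ ∀ x, 0 ≤ h x ∧ h x < K := by
  classical
  have := Fintype.ofFinite Q
  refine ⟨fun x => ((Finset.univ.filter (x < ·)).card : ℤ), Fintype.card Q + 1, ?_, ?_⟩
  · intro x y hxy
    simp only [Nat.cast_lt]
    apply Finset.card_lt_card
    rw [Finset.ssubset_iff_of_subset]
    · exact ⟨y, by simp [hxy], by simp⟩
    · intro z
      simp only [Finset.mem_filter, Finset.mem_univ, true_and]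
      exact hxy.trans
  · intro x
    have := Finset.card_le_univ (Finset.univ.filter (x < ·))
    simp only
    constructor <;> omega

/-- For every covering relation there is a strictly order-reversing integral function dropping by
exactly one along it. -/
theorem exists_strictAnti_tight [Finite Q] {a b : Q} (hab : a ⋖ b) :
    ∃ ψ : Q → ℤ, StrictAnti ψ ∧ ψ a = ψ b + 1 := by
  classical
  obtain ⟨h, K, hh, hK⟩ := exists_strictAnti_natural Q
  refine ⟨fun x => if x = b then 0 else if x = a then 1 else if x < b then h x + 2 else h x - K,
    ?_, by simp [hab.ne]⟩
  intro x y hxy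
  have hx := hK x
  have hy := hK y
  have hlt := hh hxy
  have h1 : x = b → ¬ y < b := by rintro rfl h; exact lt_asymm h hxy
  have h2 : x = b → y ≠ a := by rintro rfl rfl; exact lt_asymm hab.1 hxy
  have h3 : x = a → ¬ y < b := by rintro rfl h; exact hab.2 hxy h
  have h4 : y < b → x < b := fun h => hxy.trans h
  have h5 : y = b → x < b := by rintro rfl; exact hxy
  have h6 : y = a → x < b := by rintro rfl; exact hxy.trans hab.1
  have h7 : x = y → False := hxy.ne
  dsimp only
  split_ifs <;> first | omega | (subst_vars; simp_all)

theorem exists_grading_of_forall_conn (r : Q → Q → Prop) (hr : ∀ a b, r a b → a ⋖ b)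
    (hconv : ∀ x y, Relation.EqvGen r x y → ∀ z, x ≤ z → z ≤ y → Relation.EqvGen r x z)
    (hgr : ∀ A : Set Q, CompleteSubset A → (∀ a ∈ A, ∀ b ∈ A, Relation.EqvGen r a b) →
      IsGradedPoset A) :
    ∃ g : Q → ℤ, ∀ a b, r a b → g a = g b + 1 := by
  let s : Setoid Q := Relation.EqvGen.setoid r
  let A : Quotient s → Set Q := fun c => {x | Quotient.mk s x = c}
  have hA : ∀ c, IsGradedPoset (A c) := by
    intro c
    have key : ∀ a ∈ A c, ∀ b ∈ A c, Relation.EqvGen r a b := fun a ha b hb =>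
      Quotient.exact (s := s) (ha.trans hb.symm)
    refine hgr _ ⟨?_, ?_, ?_⟩ key
    · obtain ⟨x, rfl⟩ := Quotient.exists_rep c
      exact ⟨x, rfl⟩
    · intro x hx y hy
      have hxy := key x hx y hy
      have hsymm : Std.Symm (fun p q : Q => p ∈ A c ∧ q ∈ A c ∧ (p ≤ q ∨ q ≤ p)) :=
        ⟨fun _ _ h => ⟨h.2.1, h.1, h.2.2.symm⟩⟩
      clear hy
      induction hxy with
      | rel x y h =>
        exact .single ⟨hx, (Quotient.sound (s := s) (Relation.EqvGen.rel _ _ h)).symm.trans hx,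
          .inl (hr _ _ h).le⟩
      | refl => exact .refl
      | symm x y h ih =>
        exact Std.Symm.symm _ _ (ih ((Quotient.sound (s := s) h).trans hx))
      | trans x y z h₁ h₂ ih₁ ih₂ =>
        exact (ih₁ hx).trans (ih₂ ((Quotient.sound (s := s) h₁).symm.trans hx))
    · intro a b d hab hbd ha hd
      exact (Quotient.sound (s := s) (hconv a d (key a ha d hd) b hab hbd)).symm.trans ha
  choose γ hγ using hA
  refine ⟨fun x => γ (Quotient.mk s x) ⟨x, rfl⟩, fun a b hab => ?_⟩
  have hq : Quotient.mk s a = Quotient.mk s b := Quotient.sound (s := s) (.rel _ _ hab)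
  have aux : ∀ (c : Quotient s) (hc : Quotient.mk s a = c),
      γ (Quotient.mk s a) ⟨a, rfl⟩ = γ c ⟨a, hc⟩ := by rintro _ rfl; rfl
  dsimp only
  rw [aux _ hq]
  refine hγ _ _ _ ⟨(hr _ _ hab).lt, fun z hz₁ hz₂ => (hr _ _ hab).2 hz₁ hz₂⟩

/-- A set of order-reversing functions which are not simultaneously constant on a complete
non-graded subset admits a grading along the covering relations contracted by all of them. -/
theorem exists_grading_of_const [Finite Q] (F : Set (Q → ℤ)) (hF : ∀ ψ ∈ F, Antitone ψ)
    (hgr : ∀ A : Set Q, CompleteSubset A → (∀ ψ ∈ F, ∀ a ∈ A, ∀ b ∈ A, ψ a = ψ b) →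
      IsGradedPoset A) :
    ∃ g : Q → ℤ, ∀ a b, a ⋖ b → (∀ ψ ∈ F, ψ a = ψ b) → g a = g b + 1 := by
  have hconst : ∀ x y, Relation.EqvGen (fun a b => a ⋖ b ∧ ∀ ψ ∈ F, ψ a = ψ b) x y →
      ∀ ψ ∈ F, ψ x = ψ y := by
    intro x y h ψ hψ
    induction h with
    | rel x y h => exact h.2 ψ hψ
    | refl => rfl
    | symm x y _ ih => exact ih.symm
    | trans x y z _ _ h₁ h₂ => exact h₁.trans h₂
  have hconv : ∀ x y, Relation.EqvGen (fun a b => a ⋖ b ∧ ∀ ψ ∈ F, ψ a = ψ b) x y →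
      ∀ z, x ≤ z → z ≤ y → Relation.EqvGen (fun a b => a ⋖ b ∧ ∀ ψ ∈ F, ψ a = ψ b) x z := by
    intro x y hxy z hxz hzy
    have hc := hconst x y hxy
    have hgen := le_iff_reflTransGen_covBy_of_finite.mp hxz
    induction hgen with
    | refl => exact .refl _
    | tail h₁ h₂ ih =>
      rename_i u v
      have hxu : x ≤ u := le_iff_reflTransGen_covBy_of_finite.mpr h₁
      refine (ih hxu (h₂.le.trans hzy)).trans _ _ _ (.rel _ _ ⟨h₂, fun ψ hψ => ?_⟩)
      have a1 := hF ψ hψ hxu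
      have a2 := hF ψ hψ h₂.le
      have a3 := hF ψ hψ hzy
      have a4 := hc ψ hψ
      omega
  obtain ⟨g, hg⟩ := exists_grading_of_forall_conn _ (fun _ _ h => h.1) hconv
    fun A hA h => hgr A hA fun ψ hψ a ha b hb => hconst a b (h a ha b hb) ψ hψ
  exact ⟨g, fun a b h₁ h₂ => hg a b ⟨h₁, h₂⟩⟩

/-- Some member of `F` is constant only along the comparable pairs on which every member of `F` is
constant. -/
theorem exists_mem_generic [Finite Q] (F : AddSubmonoid (Q → ℤ)) (hF : ∀ ψ ∈ F, Antitone ψ) :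
    ∃ ψ₀ ∈ F, ∀ a b, a ≤ b → ψ₀ a = ψ₀ b → ∀ ψ ∈ F, ψ a = ψ b := by
  classical
  have := Fintype.ofFinite Q
  have hex : ∀ p : Q × Q, ∃ ψ ∈ F, ψ p.1 = ψ p.2 → ∀ ψ' ∈ F, ψ' p.1 = ψ' p.2 := by
    intro p
    by_cases h : ∃ ψ ∈ F, ψ p.1 ≠ ψ p.2
    · obtain ⟨ψ, hψ, hne⟩ := h
      exact ⟨ψ, hψ, fun h => absurd h hne⟩
    · push Not at h
      exact ⟨0, F.zero_mem, fun _ => h⟩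
  choose ψ hψF hψ using hex
  refine ⟨∑ p, ψ p, F.sum_mem fun p _ => hψF p, fun a b hab h => hψ (a, b) ?_⟩
  simp only [Finset.sum_apply] at h
  exact ((Finset.sum_eq_sum_iff_of_le fun p _ => hF _ (hψF p) hab).mp h.symm (a, b)
    (Finset.mem_univ _)).symm

end PosetLemmas

theorem exists_monotone_surjective_fin {Q : Type*} [PartialOrder Q] [Finite Q] {A : Set Q}
    (hne : A.Nonempty) (hconv : OrderConvex A) :
    ∃ κ : Q → Fin (Aᶜ.ncard + 1), Monotone κ ∧ Function.Surjective κ ∧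
      ∀ a ∈ A, ∀ b ∈ A, κ a = κ b := by
  classical
  have := Fintype.ofFinite Q
  obtain ⟨a₀, ha₀⟩ := hne
  let c : Q → ℕ := fun x => if x ∈ A then 1 else if ∃ a ∈ A, x ≤ a then 0 else 2
  let key : Q → ℕ ×ₗ LinearExtension Q := fun x =>
    toLex (c x, toLinearExtension (if x ∈ A then a₀ else x))
  have hkeyA : ∀ a ∈ A, key a = key a₀ := fun a ha => by simp [key, c, ha, ha₀]
  have hmono : Monotone key := by
    intro x y hxy
    have hc : c x < c y ∨ (c x = c y ∧ (x ∈ A ↔ y ∈ A)) := by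
      by_cases hx : x ∈ A <;> by_cases hy : y ∈ A
      · simp [c, hx, hy]
      · have : ¬ ∃ a ∈ A, y ≤ a := fun ⟨a, ha, hya⟩ => hy (hconv x y a hxy hya hx ha)
        simp [c, hx, hy, this]
      · have : ∃ a ∈ A, x ≤ a := ⟨y, hy, hxy⟩
        simp [c, hx, hy, this]
      · by_cases h : ∃ a ∈ A, y ≤ a
        · have h' : ∃ a ∈ A, x ≤ a := h.imp fun a h => ⟨h.1, hxy.trans h.2⟩
          simp [c, hx, hy, h, h']
        · by_cases h' : ∃ a ∈ A, x ≤ a <;> simp [c, hx, hy, h, h']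
    rw [Prod.Lex.le_iff]
    refine hc.imp id fun h => ⟨h.1, ?_⟩
    by_cases hx : x ∈ A
    · simp [key, hx, h.2.mp hx]
    · have hy : y ∉ A := fun hy => hx (h.2.mpr hy)
      simpa [key, hx, hy] using toLinearExtension.monotone hxy
  have hinj : Set.InjOn key Aᶜ := by
    intro x hx y hy hxy
    have := congrArg (fun z => (ofLex z).2) hxy
    simp only [key, ofLex_toLex, show x ∉ A from hx, show y ∉ A from hy, if_false] at this
    exact this
  have hcard : (Finset.univ.image key).card = Aᶜ.ncard + 1 := by
    have : (↑(Finset.univ.image key) : Set (ℕ ×ₗ LinearExtension Q)) =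
        insert (key a₀) (key '' Aᶜ) := by
      ext z
      simp only [Finset.coe_image, Finset.coe_univ, Set.image_univ, Set.mem_range,
        Set.mem_insert_iff, Set.mem_image, Set.mem_compl_iff]
      constructor
      · rintro ⟨x, rfl⟩
        by_cases hx : x ∈ A
        · exact .inl (hkeyA x hx)
        · exact .inr ⟨x, hx, rfl⟩
      · rintro (rfl | ⟨x, -, rfl⟩) <;> exact ⟨_, rfl⟩
    rw [← Set.ncard_coe_finset, this, Set.ncard_insert_of_notMem, hinj.ncard_image]
    rintro ⟨x, hx, hxa⟩
    have := congrArg (fun z => (ofLex z).1) hxa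
    by_cases h : ∃ a ∈ A, x ≤ a <;> simp [key, c, show x ∉ A from hx, ha₀, h] at this
  let iso := (Finset.univ.image key).orderIsoOfFin hcard
  have hmem : ∀ x, key x ∈ Finset.univ.image key := fun x =>
    Finset.mem_image_of_mem _ (Finset.mem_univ _)
  refine ⟨fun x => iso.symm ⟨key x, hmem x⟩, ?_, ?_, ?_⟩
  · intro x y hxy
    exact iso.symm.monotone (hmono hxy)
  · intro i
    obtain ⟨x, -, hx⟩ := Finset.mem_image.mp (iso i).2
    exact ⟨x, by rw [OrderIso.symm_apply_eq]; exact Subtype.ext hx⟩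
  · intro a ha b hb
    exact congrArg iso.symm (Subtype.ext ((hkeyA a ha).trans (hkeyA b hb).symm))

theorem ConnSubset.const_of_comparable {Q X : Type*} [PartialOrder Q] {A : Set Q}
    (hA : ConnSubset A) (f : Q → X) (h : ∀ a ∈ A, ∀ b ∈ A, a ≤ b → f a = f b) :
    ∀ a ∈ A, ∀ b ∈ A, f a = f b := by
  intro a ha b hb
  induction hA a ha b hb with
  | refl => rfl
  | tail _ h₂ ih =>
    refine (ih h₂.1).trans ?_
    rcases h₂.2.2 with h' | h'
    · exact h _ h₂.1 _ h₂.2.1 h'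
    · exact (h _ h₂.2.1 _ h₂.1 h').symm

section HibiRing

variable (k : Type) [Field k] (P : Type) [PartialOrder P]

/-- the additive monoid of lattice points of the cone `C(P)` -/
def hibiCone : AddSubmonoid (Pbar P → ℤ) where
  carrier := {ψ | InConeP P ψ}
  zero_mem' := ⟨antitone_const, rfl⟩
  add_mem' h₁ h₂ := ⟨h₁.1.add h₂.1, by simp [h₁.2, h₂.2]⟩

variable {P}

theorem InConeP.nonneg {ψ : Pbar P → ℤ} (h : InConeP P ψ) (x : Pbar P) : 0 ≤ ψ x :=
  h.2 ▸ h.1 le_top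

theorem hibiMono_add (ψ ψ' : Pbar P → ℤ) :
    hibiMono k P (ψ + ψ') = hibiMono k P ψ * hibiMono k P ψ' := by
  simp [hibiMono, AddMonoidAlgebra.single_mul_single]

variable {k} in
theorem hibiMono_mem {ψ : Pbar P → ℤ} (h : InConeP P ψ) : hibiMono k P ψ ∈ hibiRing k P :=
  Algebra.subset_adjoin ⟨ψ, h, rfl⟩

/-- the monomials of the Hibi ring, as a monoid homomorphism -/
noncomputable def hibiMonoHom : Multiplicative (hibiCone P) →* hibiRing k P where
  toFun ψ := ⟨hibiMono k P ψ.toAdd, hibiMono_mem ψ.toAdd.2⟩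
  map_one' := rfl
  map_mul' _ _ := Subtype.ext (hibiMono_add k _ _)

theorem adjoin_range_hibiMonoHom :
    Algebra.adjoin k (Set.range (hibiMonoHom k (P := P))) = ⊤ := by
  apply Subalgebra.map_injective (f := (hibiRing k P).val) Subtype.val_injective
  rw [AlgHom.map_adjoin, Algebra.map_top, Subalgebra.range_val]
  conv_rhs => rw [hibiRing]
  congr 1
  ext f
  constructor
  · rintro ⟨_, ⟨ψ, rfl⟩, rfl⟩
    exact ⟨_, ψ.toAdd.2, rfl⟩
  · rintro ⟨ψ, hψ, rfl⟩
    exact ⟨_, ⟨Multiplicative.ofAdd ⟨ψ, hψ⟩, rfl⟩, rfl⟩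

variable {k}

theorem span_range_hibiMonoHom :
    Submodule.span k (Set.range (hibiMonoHom k (P := P))) = ⊤ := by
  have h := Algebra.adjoin_eq_span k (Set.range (hibiMonoHom k (P := P)))
  rw [adjoin_range_hibiMonoHom, Algebra.top_toSubmodule, ← MonoidHom.coe_mrange,
    Submonoid.closure_eq, MonoidHom.coe_mrange] at h
  exact h.symm

@[simp]
theorem coe_hibiMonoHom (ψ : Multiplicative (hibiCone P)) :
    (hibiMonoHom k ψ : AddMonoidAlgebra k (Pbar P → ℤ)) = hibiMono k P ψ.toAdd := rfl

theorem hibiRing_induction {p : hibiRing k P → Prop} (f : hibiRing k P)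
    (mono : ∀ ψ, p (hibiMonoHom k ψ)) (zero : p 0) (add : ∀ f g, p f → p g → p (f + g))
    (smul : ∀ (c : k) f, p f → p (c • f)) : p f := by
  have hf : f ∈ Submodule.span k (Set.range (hibiMonoHom k (P := P))) := by
    rw [span_range_hibiMonoHom]
    trivial
  induction hf using Submodule.span_induction with
  | mem _ h => obtain ⟨ψ, rfl⟩ := h; exact mono ψ
  | zero => exact zero
  | add f g _ _ hf hg => exact add f g hf hg
  | smul c f _ hf => exact smul c f hf

theorem InConeP.of_coeff_ne_zero (f : hibiRing k P) {ψ : Pbar P → ℤ}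
    (h : (f : AddMonoidAlgebra k (Pbar P → ℤ)).coeff ψ ≠ 0) : InConeP P ψ := by
  classical
  revert h
  induction f using hibiRing_induction with
  | mono ψ' =>
    intro h
    have : (ψ'.toAdd : Pbar P → ℤ) = ψ := by
      by_contra hne
      simp [hibiMono, hne] at h
    exact this ▸ ψ'.toAdd.2
  | zero => simp
  | add f g hf hg =>
    intro h
    by_contra hψ
    have h₁ := not_imp_not.mpr hf hψ
    have h₂ := not_imp_not.mpr hg hψ
    rw [not_not] at h₁ h₂
    simp [h₁, h₂] at h
  | smul c f hf =>
    intro h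
    exact hf fun h₀ => by simp [h₀] at h

/-- The monomials outside a face of the cone span a prime ideal. -/
theorem exists_isPrime_of_face (F : Set (Pbar P → ℤ)) (h0 : 0 ∈ F)
    (hF : ∀ ψ ψ', InConeP P ψ → InConeP P ψ' → (ψ + ψ' ∈ F ↔ ψ ∈ F ∧ ψ' ∈ F)) :
    ∃ p : Ideal (hibiRing k P), p.IsPrime ∧
      ∀ f, f ∈ p ↔ ∀ ψ ∈ F, (f : AddMonoidAlgebra k (Pbar P → ℤ)).coeff ψ = 0 := by
  classical
  let π : hibiRing k P → AddMonoidAlgebra k (Pbar P → ℤ) := fun f =>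
    .ofCoeff ((f : AddMonoidAlgebra k (Pbar P → ℤ)).coeff.filter (· ∈ F))
  have hadd : ∀ f g, π (f + g) = π f + π g := fun f g => by
    simp [π, Finsupp.filter_add]
  have hsmul : ∀ (c : k) f, π (c • f) = c • π f := fun c f => by
    simp [π, Finsupp.filter_smul]
  have hzero : π 0 = 0 := by simp [π, Finsupp.filter_zero]
  have hmono : ∀ ψ, π (hibiMonoHom k ψ) =
      if (ψ.toAdd : Pbar P → ℤ) ∈ F then hibiMono k P ψ.toAdd else 0 := by
    intro ψ
    split_ifs with h <;> simp [π, hibiMono, h]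
  have hmul : ∀ f g, π (f * g) = π f * π g := by
    intro f g
    induction f using hibiRing_induction with
    | mono ψ =>
      induction g using hibiRing_induction with
      | mono ψ' =>
        rw [← map_mul, hmono, hmono, hmono]
        have := hF _ _ ψ.toAdd.2 ψ'.toAdd.2
        have hs : (((ψ * ψ').toAdd : hibiCone P) : Pbar P → ℤ) = ψ.toAdd + ψ'.toAdd := rfl
        rw [hs, hibiMono_add]
        by_cases h₁ : (ψ.toAdd : Pbar P → ℤ) ∈ F <;> by_cases h₂ : (ψ'.toAdd : Pbar P → ℤ) ∈ F <;>
          simp [this, h₁, h₂]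
      | zero => simp [hzero]
      | add g g' h h' => rw [mul_add, hadd, hadd, mul_add, h, h']
      | smul c g h => rw [mul_smul_comm, hsmul, hsmul, mul_smul_comm, h]
    | zero => simp [hzero]
    | add g g' h h' => rw [add_mul, hadd, hadd, add_mul, h, h']
    | smul c g h => rw [smul_mul_assoc, hsmul, hsmul, smul_mul_assoc, h]
  have hone : π 1 = 1 := by
    have := hmono 1
    rw [map_one] at this
    rw [this]
    simp only [toAdd_one, ZeroMemClass.coe_zero, h0, if_true]
    rfl
  let Φ : hibiRing k P →+* AddMonoidAlgebra k (Pbar P → ℤ) :=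
    { toFun := π, map_one' := hone, map_mul' := hmul, map_zero' := hzero, map_add' := hadd }
  refine ⟨RingHom.ker Φ, RingHom.ker_isPrime Φ, fun f => ?_⟩
  rw [RingHom.mem_ker]
  change π f = 0 ↔ _
  rw [← AddMonoidAlgebra.coeff_eq_zero]
  simp only [π, Finsupp.filter_eq_zero_iff]

theorem hibiMono_mem_hibiOmega {ψ : Pbar P → ℤ} (h0 : ψ ⊤ = 0)
    (h : ∀ a b : Pbar P, a ⋖ b → ψ b + 1 ≤ ψ a) : hibiMono k P ψ ∈ hibiOmega k P :=
  Submodule.subset_span ⟨ψ, h0, h, rfl⟩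

theorem inConeP_of_covBy [Finite P] {ψ : Pbar P → ℤ} (h0 : ψ ⊤ = 0)
    (h : ∀ a b : Pbar P, a ⋖ b → ψ b + 1 ≤ ψ a) : InConeP P ψ := by
  have : Finite (Pbar P) := inferInstanceAs (Finite (Option (Option P)))
  exact ⟨antitone_of_forall_covBy fun a b hab => by linarith [h a b hab], h0⟩

/-- Monomials in the trace: a nonnegative multiple of a point whose contracted covering relations
admit a grading. -/
theorem exists_nsmul_mem_hibiTrace [Finite P] {ψ₀ : Pbar P → ℤ} (h : InConeP P ψ₀) (g : Pbar P → ℤ)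
    (hg : ∀ a b, a ⋖ b → ψ₀ a = ψ₀ b → g a = g b + 1) :
    ∃ (N : ℕ) (hN : InConeP P (N • ψ₀)), (⟨hibiMono k P (N • ψ₀), hibiMono_mem hN⟩ : hibiRing k P) ∈
      hibiTrace k P := by
  have : Finite (Pbar P) := inferInstanceAs (Finite (Option (Option P)))
  have := Fintype.ofFinite (Pbar P)
  wlog hg0 : g ⊤ = 0 generalizing g
  · exact this (fun x => g x - g ⊤) (fun a b h₁ h₂ => by rw [hg a b h₁ h₂]; ring) (by simp)
  let N : ℕ := 2 * ∑ x, (g x).natAbs + 1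
  have hN : ∀ x, (g x).natAbs ≤ ∑ x, (g x).natAbs := fun x =>
    Finset.single_le_sum (f := fun x => (g x).natAbs) (fun _ _ => Nat.zero_le _) (Finset.mem_univ x)
  have hcov : ∀ a b, a ⋖ b → (ψ₀ a = ψ₀ b ∧ g a = g b + 1) ∨
      ((N : ℤ) * ψ₀ b + 1 + |g a - g b| ≤ N * ψ₀ a) := by
    intro a b hab
    rcases (h.1 hab.le).eq_or_lt with he | hlt
    · exact .inl ⟨he.symm, hg a b hab he.symm⟩
    · right
      have h₁ : (N : ℤ) * (ψ₀ b + 1) ≤ N * ψ₀ a := by gcongr; exact hlt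
      have h₂ : 1 + |g a - g b| ≤ (N : ℤ) := by
        have ha := hN a
        have hb := hN b
        have hab := abs_sub (g a) (g b)
        rw [← Int.natCast_natAbs (g a), ← Int.natCast_natAbs (g b)] at hab
        omega
      linarith
  let ψ₁ : Pbar P → ℤ := fun x => N * ψ₀ x + g x
  let ψ₂ : Pbar P → ℤ := fun x => N * ψ₀ x - g x
  have hψ₁ : ∀ a b, a ⋖ b → ψ₁ b + 1 ≤ ψ₁ a := by
    intro a b hab
    rcases hcov a b hab with ⟨h₁, h₂⟩ | h₁
    · simp only [ψ₁, h₁, h₂]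
      linarith
    · linarith [neg_abs_le (g a - g b)]
  have hψ₂ : ∀ a b, a ⋖ b → ψ₂ b - 1 ≤ ψ₂ a := by
    intro a b hab
    rcases hcov a b hab with ⟨h₁, h₂⟩ | h₁
    · simp only [ψ₂, h₁, h₂]
      linarith
    · linarith [le_abs_self (g a - g b)]
  have hsum : (2 * N) • ψ₀ = ψ₂ + ψ₁ := by
    ext x
    simp only [ψ₁, ψ₂, Pi.smul_apply, Pi.add_apply, nsmul_eq_mul, Nat.cast_mul]
    push_cast
    ring
  have hmul : ∀ f ∈ hibiOmega k P, hibiMono k P ψ₂ * f ∈ hibiRing k P := by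
    intro f hf
    induction hf using Submodule.span_induction with
    | mem _ hf =>
      obtain ⟨ψ, h0, hψ, rfl⟩ := hf
      rw [← hibiMono_add]
      refine hibiMono_mem ⟨antitone_of_forall_covBy fun a b hab => ?_, by simp [h0, ψ₂, h.2, hg0]⟩
      simp only [Pi.add_apply]
      linarith [hψ a b hab, hψ₂ a b hab]
    | zero => simp
    | add f f' _ _ h h' => rw [mul_add]; exact add_mem h h'
    | smul c f _ hf =>
      rw [mul_smul_comm]
      exact mul_mem c.2 hf
  let μ : hibiOmega k P →ₗ[hibiRing k P] hibiRing k P :=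
    { toFun := fun f => ⟨hibiMono k P ψ₂ * f, hmul f f.2⟩
      map_add' := fun f f' => Subtype.ext (mul_add _ _ _)
      map_smul' := fun c f => Subtype.ext (mul_smul_comm _ _ _) }
  refine ⟨2 * N, (hibiCone P).nsmul_mem h _, Ideal.subset_span
    ⟨μ, ⟨hibiMono k P ψ₁, hibiMono_mem_hibiOmega (by simp [ψ₁, h.2, hg0]) hψ₁⟩, ?_⟩⟩
  apply Subtype.ext
  change hibiMono k P ψ₂ * hibiMono k P ψ₁ = _
  rw [← hibiMono_add, ← hsum]

end HibiRing

section HibiTraceFace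

variable {k : Type} [Field k] {P : Type} [PartialOrder P]

theorem hibiMono_mul_apply_comm (φ : hibiOmega k P →ₗ[hibiRing k P] hibiRing k P)
    {ψ₁ ψ₂ : Pbar P → ℤ} (h₁ : InConeP P ψ₁) (h₂ : InConeP P ψ₂)
    (h₁' : hibiMono k P ψ₁ ∈ hibiOmega k P) (h₂' : hibiMono k P ψ₂ ∈ hibiOmega k P) :
    hibiMono k P ψ₁ * (φ ⟨hibiMono k P ψ₂, h₂'⟩ : AddMonoidAlgebra k (Pbar P → ℤ)) =
      hibiMono k P ψ₂ * (φ ⟨hibiMono k P ψ₁, h₁'⟩ : AddMonoidAlgebra k (Pbar P → ℤ)) := by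
  let r₁ : hibiRing k P := ⟨hibiMono k P ψ₁, hibiMono_mem h₁⟩
  let r₂ : hibiRing k P := ⟨hibiMono k P ψ₂, hibiMono_mem h₂⟩
  have h : r₁ • (⟨hibiMono k P ψ₂, h₂'⟩ : hibiOmega k P) = r₂ • ⟨hibiMono k P ψ₁, h₁'⟩ :=
    Subtype.ext (mul_comm (hibiMono k P ψ₁) (hibiMono k P ψ₂))
  have := congrArg φ h
  rw [φ.map_smul, φ.map_smul] at this
  exact congrArg Subtype.val this

/-- The trace ideal vanishes along every face whose points are constant on a given complete
non-graded subset. -/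
theorem hibiTrace_le_of_face [Finite P] {A : Set (Pbar P)} (hA : CompleteSubset A)
    (hgr : ¬ IsGradedPoset A) {F : Set (Pbar P → ℤ)}
    (hF : ∀ ψ ∈ F, ∀ a ∈ A, ∀ b ∈ A, ψ a = ψ b) {p : Ideal (hibiRing k P)}
    (hp : ∀ f, f ∈ p ↔ ∀ ψ ∈ F, (f : AddMonoidAlgebra k (Pbar P → ℤ)).coeff ψ = 0) :
    hibiTrace k P ≤ p := by
  have : Finite (Pbar P) := inferInstanceAs (Finite (Option (Option P)))
  refine Ideal.span_le.mpr ?_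
  rintro _ ⟨φ, ⟨x, hx⟩, rfl⟩
  have hle : hibiOmega k P ≤ (Submodule.comap φ p).map (hibiOmega k P).subtype := by
    refine Submodule.span_le.mpr ?_
    rintro _ ⟨ψ₁, h0, hψ₁, rfl⟩
    refine ⟨⟨hibiMono k P ψ₁, hibiMono_mem_hibiOmega h0 hψ₁⟩, ?_, rfl⟩
    rw [SetLike.mem_coe, Submodule.mem_comap, hp]
    intro ψ hψ
    by_contra hne
    apply hgr
    refine ⟨fun a => ψ₁ a, fun a b hab => ?_⟩
    have hab' := hA.2.2.covBy_of_covBy hab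
    obtain ⟨χ, hχ, htight⟩ := exists_strictAnti_tight hab'
    let χ₀ : Pbar P → ℤ := fun x => χ x - χ ⊤
    have hχ0 : χ₀ ⊤ = 0 := sub_self _
    have hχc : ∀ a b, a ⋖ b → χ₀ b + 1 ≤ χ₀ a := fun a b hab => by
      have := hχ hab.lt
      simp only [χ₀]
      omega
    have hcomm := hibiMono_mul_apply_comm φ (inConeP_of_covBy h0 hψ₁) (inConeP_of_covBy hχ0 hχc)
      (hibiMono_mem_hibiOmega h0 hψ₁) (hibiMono_mem_hibiOmega hχ0 hχc)
    have hcone : InConeP P (χ₀ + ψ - ψ₁) := by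
      apply InConeP.of_coeff_ne_zero
        (φ ⟨hibiMono k P χ₀, hibiMono_mem_hibiOmega hχ0 hχc⟩)
      have := congrArg (fun f => f.coeff (χ₀ + ψ)) hcomm
      simp only [hibiMono, AddMonoidAlgebra.coeff_single_mul_apply, one_mul] at this
      rw [show -ψ₁ + (χ₀ + ψ) = χ₀ + ψ - ψ₁ by abel, show (-χ₀ + (χ₀ + ψ)) = ψ by abel] at this
      exact this ▸ hne
    have h₁ := hcone.1 hab'.le
    have h₂ := hψ₁ _ _ hab'
    have h₃ := hF ψ hψ a a.2 b b.2
    simp only [χ₀, Pi.add_apply, Pi.sub_apply] at h₁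
    change ψ₁ a = ψ₁ b + 1
    omega
  obtain ⟨y, hy, rfl⟩ := hle hx
  exact hy

end HibiTraceFace

/-- The transcendence degree of the quotient of a monomial algebra by a prime ideal is bounded by
the rank of the monoid of monomials outside of the ideal. -/
theorem trdeg_quotient_le_card_of_monomials {k R M τ : Type} [Field k] [CommRing R] [Algebra k R]
    [AddCommMonoid M] [Fintype τ] (μ : Multiplicative M →* R)
    (hμ : Submodule.span k (Set.range μ) = ⊤) (p : Ideal R) [p.IsPrime] (S : AddSubmonoid M)
    (hS : ∀ m, μ (.ofAdd m) ∉ p → m ∈ S) (e : S →+ (τ → ℤ)) (he : Function.Injective e) :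
    Algebra.trdeg k (R ⧸ p) ≤ Fintype.card τ := by
  let χ : Multiplicative S →* R ⧸ p :=
    (Ideal.Quotient.mk p : R →* R ⧸ p).comp (μ.comp (AddMonoidHom.toMultiplicative S.subtype))
  refine trdeg_le_card_of_monomials χ ?_ e he
  rw [eq_top_iff]
  rintro x -
  obtain ⟨f, rfl⟩ := Ideal.Quotient.mk_surjective x
  have hf : f ∈ Submodule.span k (Set.range μ) := hμ ▸ Submodule.mem_top
  induction hf using Submodule.span_induction with
  | mem _ h =>
    obtain ⟨ψ, rfl⟩ := h
    by_cases h : μ ψ ∈ p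
    · rw [Ideal.Quotient.eq_zero_iff_mem.mpr h]
      exact zero_mem _
    · exact Algebra.subset_adjoin ⟨Multiplicative.ofAdd ⟨ψ.toAdd, hS _ h⟩, rfl⟩
  | zero => rw [map_zero]; exact zero_mem _
  | add f g _ _ hf hg => rw [map_add]; exact add_mem hf hg
  | smul c f _ hf => exact Subalgebra.smul_mem _ hf c

section Dimension

variable {k : Type} [Field k] {P : Type} [PartialOrder P]

theorem ncard_compl_pbar [Fintype P] (A : Set (Pbar P)) :
    Aᶜ.ncard = Fintype.card P + 2 - A.ncard := by
  have : Finite (Pbar P) := inferInstanceAs (Finite (Option (Option P)))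
  have h : Nat.card (Pbar P) = Fintype.card P + 2 := by
    change Nat.card (Option (Option P)) = _
    rw [Nat.card_eq_fintype_card, Fintype.card_option, Fintype.card_option]
  have := Set.ncard_add_ncard_compl A
  omega

theorem ncard_compl_le_ringKrullDim [Finite P] {A : Set (Pbar P)} (hA : CompleteSubset A)
    (hgr : ¬ IsGradedPoset A) :
    (Aᶜ.ncard : WithBot ℕ∞) ≤ ringKrullDim (hibiRing k P ⧸ hibiTrace k P) := by
  classical
  have : Finite (Pbar P) := inferInstanceAs (Finite (Option (Option P)))
  obtain ⟨κ, hκ, hsurj, hconst⟩ := exists_monotone_surjective_fin hA.1 hA.2.2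
  let F : Fin (Aᶜ.ncard + 1) → Set (Pbar P → ℤ) := fun i =>
    {ψ | (∀ a ∈ A, ∀ b ∈ A, ψ a = ψ b) ∧ ∀ x, i ≤ κ x → ψ x = 0}
  have hface : ∀ i ψ ψ', InConeP P ψ → InConeP P ψ' → (ψ + ψ' ∈ F i ↔ ψ ∈ F i ∧ ψ' ∈ F i) := by
    intro i ψ ψ' h h'
    constructor
    · rintro ⟨h₁, h₂⟩
      have hle : ∀ a ∈ A, ∀ b ∈ A, a ≤ b → ψ a = ψ b ∧ ψ' a = ψ' b := by
        intro a ha b hb hab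
        have h₃ := h₁ a ha b hb
        have h₄ := h.1 hab
        have h₅ := h'.1 hab
        simp only [Pi.add_apply] at h₃
        constructor <;> omega
      have hz : ∀ x, i ≤ κ x → ψ x = 0 ∧ ψ' x = 0 := by
        intro x hx
        have h₃ := h₂ x hx
        have h₄ := h.nonneg x
        have h₅ := h'.nonneg x
        simp only [Pi.add_apply] at h₃
        constructor <;> omega
      exact ⟨⟨hA.2.1.const_of_comparable ψ fun a ha b hb hab => (hle a ha b hb hab).1,
        fun x hx => (hz x hx).1⟩,
        ⟨hA.2.1.const_of_comparable ψ' fun a ha b hb hab => (hle a ha b hb hab).2,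
        fun x hx => (hz x hx).2⟩⟩
    · rintro ⟨⟨h₁, h₂⟩, ⟨h₁', h₂'⟩⟩
      exact ⟨fun a ha b hb => by simp [h₁ a ha b hb, h₁' a ha b hb],
        fun x hx => by simp [h₂ x hx, h₂' x hx]⟩
  choose p hprime hp using fun i =>
    exists_isPrime_of_face (k := k) (F i) ⟨by simp, by simp⟩ (hface i)
  let q : Fin (Aᶜ.ncard + 1) → PrimeSpectrum.zeroLocus (hibiTrace k P : Set (hibiRing k P)) :=
    fun i => ⟨⟨p i, hprime i⟩, hibiTrace_le_of_face hA hgr (fun ψ hψ => hψ.1) (hp i)⟩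
  have hanti : ∀ i j, i < j → q j < q i := by
    intro i j hij
    have hsub : F i ⊆ F j := fun ψ hψ => ⟨hψ.1, fun x hx => hψ.2 x (hij.le.trans hx)⟩
    change p j < p i
    refine lt_of_le_not_ge (fun f hf => (hp i f).mpr fun ψ hψ => (hp j f).mp hf ψ (hsub hψ)) ?_
    intro hle
    let ψ : Pbar P → ℤ := fun x => if κ x < j then 1 else 0
    have hψ : InConeP P ψ := by
      constructor
      · intro x y hxy
        have := hκ hxy
        by_cases hy : κ y < j
        · simp [ψ, hy, this.trans_lt hy]
        · by_cases hx : κ x < j <;> simp [ψ, hx, hy]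
      · obtain ⟨x, hx⟩ := hsurj j
        have : j ≤ κ ⊤ := hx ▸ hκ le_top
        simp [ψ, this]
    have hψj : ψ ∈ F j :=
      ⟨fun a ha b hb => by simp only [ψ, hconst a ha b hb], fun x hx => by simp [ψ, hx]⟩
    have hmem : (⟨hibiMono k P ψ, hibiMono_mem hψ⟩ : hibiRing k P) ∈ p i := by
      rw [hp]
      intro ψ' hψ'
      have hne : ψ ≠ ψ' := by
        rintro rfl
        obtain ⟨x, hx⟩ := hsurj i
        have := hψ'.2 x hx.ge
        simp [ψ, hx, hij] at this
      simp [hibiMono, hne]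
    have := (hp j _).mp (hle hmem) ψ hψj
    simp [hibiMono] at this
  rw [ringKrullDim_quotient]
  have hmono : StrictMono fun i => q (Fin.rev i) := fun i j hij =>
    hanti _ _ (Fin.rev_lt_rev.mpr hij)
  exact Order.LTSeries.length_le_krullDim ⟨Aᶜ.ncard, fun i => q (Fin.rev i),
    fun i => hmono i.castSucc_lt_succ⟩

theorem trdeg_quotient_le_ncard_compl [Finite P] (p : Ideal (hibiRing k P)) [p.IsPrime]
    (hle : hibiTrace k P ≤ p) :
    ∃ A : Set (Pbar P), CompleteSubset A ∧ ¬ IsGradedPoset A ∧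
      Algebra.trdeg k (hibiRing k P ⧸ p) ≤ Aᶜ.ncard := by
  classical
  have : Finite (Pbar P) := inferInstanceAs (Finite (Option (Option P)))
  let S : AddSubmonoid (hibiCone P) :=
    { carrier := {ψ | hibiMonoHom k (.ofAdd ψ) ∉ p}
      zero_mem' := by
        simp only [Set.mem_ofPred_eq, ofAdd_zero, map_one]
        exact fun h => ‹p.IsPrime›.ne_top ((Ideal.eq_top_iff_one p).mpr h)
      add_mem' := by
        intro ψ ψ' h h'
        simp only [Set.mem_ofPred_eq, ofAdd_add, map_mul] at h h' ⊢
        exact fun hm => (‹p.IsPrime›.mem_or_mem hm).elim h h' }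
  let F : AddSubmonoid (Pbar P → ℤ) := S.map (hibiCone P).subtype
  have hFanti : ∀ ψ ∈ F, Antitone ψ := by
    rintro _ ⟨ψ, -, rfl⟩
    exact ψ.2.1
  obtain ⟨A, hA, hgr, hAF⟩ : ∃ A : Set (Pbar P), CompleteSubset A ∧ ¬ IsGradedPoset A ∧
      ∀ ψ ∈ F, ∀ a ∈ A, ∀ b ∈ A, ψ a = ψ b := by
    by_contra! hcon
    obtain ⟨g, hg⟩ := exists_grading_of_const (F : Set (Pbar P → ℤ)) hFanti fun A hA hAF => by
      by_contra hgr
      obtain ⟨ψ, hψ, a, ha, b, hb, hne⟩ := hcon A hA hgr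
      exact hne (hAF ψ hψ a ha b hb)
    obtain ⟨_, ⟨ψ₀, hψ₀, rfl⟩, hgen⟩ := exists_mem_generic F hFanti
    obtain ⟨N, hN, hmem⟩ := exists_nsmul_mem_hibiTrace (k := k) ψ₀.2 g
      fun a b hab h => hg a b hab (hgen a b hab.le h)
    exact S.nsmul_mem hψ₀ N (hle hmem)
  refine ⟨A, hA, hgr, ?_⟩
  obtain ⟨a₀, ha₀⟩ := hA.1
  have hconst : ∀ ψ : S, ∀ a ∈ A, ∀ b ∈ A, (ψ : Pbar P → ℤ) a = (ψ : Pbar P → ℤ) b := fun ψ =>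
    hAF _ ⟨ψ, ψ.2, rfl⟩
  let e : S →+ ((Aᶜ : Set (Pbar P)) → ℤ) :=
    { toFun := fun ψ q => if (q : Pbar P) = ⊤ then (ψ : Pbar P → ℤ) a₀ else (ψ : Pbar P → ℤ) q
      map_zero' := by ext; simp
      map_add' := fun ψ ψ' => by
        ext q
        by_cases h : (q : Pbar P) = ⊤ <;> simp [h] }
  have he : Function.Injective e := by
    intro ψ ψ' heq
    have ha : (ψ : Pbar P → ℤ) a₀ = (ψ' : Pbar P → ℤ) a₀ := by
      by_cases ht : ⊤ ∈ A
      · rw [hconst ψ a₀ ha₀ ⊤ ht, hconst ψ' a₀ ha₀ ⊤ ht, ψ.1.2.2, ψ'.1.2.2]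
      · simpa [e] using congrFun heq ⟨⊤, ht⟩
    apply Subtype.ext
    apply Subtype.ext
    ext q
    by_cases hq : q ∈ A
    · rw [hconst ψ q hq a₀ ha₀, hconst ψ' q hq a₀ ha₀, ha]
    · by_cases ht : q = ⊤
      · rw [ht, ψ.1.2.2, ψ'.1.2.2]
      · simpa [e, ht] using congrFun heq ⟨q, hq⟩
  have := Fintype.ofFinite (Aᶜ : Set (Pbar P))
  have hdeg := trdeg_quotient_le_card_of_monomials (hibiMonoHom k) span_range_hibiMonoHom p S
    (fun _ h => h) e he
  rwa [← Nat.card_eq_fintype_card, Nat.card_coe_set_eq] at hdeg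

theorem ringKrullDim_quotient_hibiTrace_le [Finite P] (d : ℕ)
    (h : ∀ A : Set (Pbar P), CompleteSubset A → ¬ IsGradedPoset A → Aᶜ.ncard ≤ d) :
    ringKrullDim (hibiRing k P ⧸ hibiTrace k P) ≤ d := by
  rw [ringKrullDim_quotient]
  refine iSup_le fun s => ?_
  obtain ⟨x, hx⟩ := exists_algebraicIndependent_of_strictMono (k := k) s.length
    (fun i => (s i : PrimeSpectrum (hibiRing k P))) fun i j hij => s.strictMono hij
  have := (s 0).1.isPrime
  obtain ⟨A, hA, hgr, hdeg⟩ := trdeg_quotient_le_ncard_compl (k := k)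
    (s 0 : PrimeSpectrum (hibiRing k P)).asIdeal (s 0).2
  have hlen : (s.length : Cardinal.{0}) ≤ Aᶜ.ncard := by
    simpa using hx.cardinalMk_le_trdeg.trans hdeg
  exact_mod_cast (Nat.cast_le.mp hlen).trans (h A hA hgr)

end Dimension

/-- If `P̄` has at least one complete non-graded subset, then the Krull
dimension of `R(P)/tr(ω)` (the dimension of the non-Gorenstein locus of the Hibi ring)
equals the maximum of `#P - #A + 2` over all complete non-graded subsets `A ⊆ P̄`. -/
theorem hibi_locus_dimension
    (k : Type) [Field k] [IsAlgClosed k] [CharZero k]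
    (P : Type) [Fintype P] [PartialOrder P]
    (h : ∃ A : Set (Pbar P), CompleteSubset A ∧ ¬ IsGradedPoset ↥A) :
    ringKrullDim (↥(hibiRing k P) ⧸ hibiTrace k P) =
      (↑(sSup {d : ℕ | ∃ A : Set (Pbar P), CompleteSubset A ∧ ¬ IsGradedPoset ↥A ∧
          d = Fintype.card P + 2 - A.ncard}) : WithBot ℕ∞) := by
  set D := {d : ℕ | ∃ A : Set (Pbar P), CompleteSubset A ∧ ¬ IsGradedPoset ↥A ∧
    d = Fintype.card P + 2 - A.ncard}
  have hbdd : BddAbove D := by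
    refine ⟨Fintype.card P + 2, ?_⟩
    rintro _ ⟨A, -, -, rfl⟩
    exact Nat.sub_le _ _
  have hne : D.Nonempty := h.elim fun A hA => ⟨_, A, hA.1, hA.2, rfl⟩
  refine le_antisymm ?_ ?_
  · exact ringKrullDim_quotient_hibiTrace_le _ fun A hA hgr =>
      le_csSup hbdd ⟨A, hA, hgr, ncard_compl_pbar A⟩
  · obtain ⟨A, hA, hgr, hd⟩ := Nat.sSup_mem hne hbdd
    rw [hd, ← ncard_compl_pbar]
    exact ncard_compl_le_ringKrullDim hA hgr
end

section
/- Let A be a complete subset of P̄. Then A is not graded if and only if there exist a natural number u ≥ 1 and elements a_1, b_1, a_2, b_2, …, a_u, b_u of A with a_1 < b_1 > a_2 < b_2 > ⋯ > a_u < b_u > a_1, satisfying the inequality rank(a_1, b_1) + ⋯ + rank(a_u, b_u) > dist(a_2, b_1) + dist(a_3, b_2) + ⋯ + dist(a_u, b_{u−1}) + dist(a_1, b_u). -/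
/-- there is a saturated chain `a = c_0 ⋖ c_1 ⋖ ⋯ ⋖ c_l = b` of length `l` from `a` to `b` -/
def SatChain {Q : Type*} [PartialOrder Q] (a b : Q) (l : ℕ) : Prop :=
  ∃ c : Fin (l + 1) → Q, c 0 = a ∧ c (Fin.last l) = b ∧
    ∀ i : Fin l, c i.castSucc ⋖ c i.succ

/-- `rank(a, b)`: the maximal length of a saturated chain from `a` to `b` -/
noncomputable def chainRank {Q : Type*} [PartialOrder Q] (a b : Q) : ℕ :=
  sSup {l : ℕ | SatChain a b l}

/-- `dist(a, b)`: the minimal length of a saturated chain from `a` to `b` -/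
noncomputable def chainDist {Q : Type*} [PartialOrder Q] (a b : Q) : ℕ :=
  sInf {l : ℕ | SatChain a b l}

section ZigzagGrading

variable {Q : Type*} [PartialOrder Q]

theorem satChain_zero_iff {a b : Q} : SatChain a b 0 ↔ a = b := by
  constructor
  · rintro ⟨c, rfl, rfl, -⟩
    rfl
  · rintro rfl
    exact ⟨fun _ => a, rfl, rfl, fun i => i.elim0⟩

theorem satChain_succ_iff {a b : Q} {l : ℕ} :
    SatChain a b (l + 1) ↔ ∃ c, SatChain a c l ∧ c ⋖ b := by
  constructor
  · rintro ⟨c, rfl, rfl, hc⟩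
    exact ⟨c (Fin.last l).castSucc,
      ⟨fun i => c i.castSucc, rfl, rfl, fun i => hc i.castSucc⟩, hc (Fin.last l)⟩
  · rintro ⟨x, ⟨c, rfl, rfl, hc⟩, hx⟩
    refine ⟨Fin.snoc (α := fun _ => Q) c b, ?_, Fin.snoc_last _ _, fun i => ?_⟩
    · exact Fin.snoc_castSucc (α := fun _ => Q) b c 0
    · induction i using Fin.lastCases with
      | last => rw [Fin.snoc_castSucc, Fin.succ_last, Fin.snoc_last]; exact hx
      | cast i => rw [Fin.snoc_castSucc, Fin.succ_castSucc, Fin.snoc_castSucc]; exact hc i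

theorem SatChain.trans {a b c : Q} {l m : ℕ} (h : SatChain a b l) (h' : SatChain b c m) :
    SatChain a c (l + m) := by
  induction m generalizing c with
  | zero => rw [satChain_zero_iff] at h'; exact h' ▸ h
  | succ m ih =>
    obtain ⟨x, hx, hxc⟩ := satChain_succ_iff.1 h'
    exact satChain_succ_iff.2 ⟨x, ih hx, hxc⟩

theorem CovBy.satChain {a b : Q} (h : a ⋖ b) : SatChain a b 1 :=
  satChain_succ_iff.2 ⟨a, satChain_zero_iff.2 rfl, h⟩

theorem SatChain.le {a b : Q} {l : ℕ} (h : SatChain a b l) : a ≤ b := by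
  induction l generalizing b with
  | zero => exact (satChain_zero_iff.1 h).le
  | succ l ih =>
    obtain ⟨x, hx, hxb⟩ := satChain_succ_iff.1 h
    exact (ih hx).trans hxb.le

theorem exists_satChain [Finite Q] {a b : Q} (h : a ≤ b) : ∃ l, SatChain a b l := by
  induction b using WellFoundedLT.induction with
  | ind b ih =>
    rcases h.eq_or_lt with rfl | hab
    · exact ⟨0, satChain_zero_iff.2 rfl⟩
    · obtain ⟨x, hax, hxb⟩ := exists_le_covBy_of_lt hab
      obtain ⟨l, hl⟩ := ih x hxb.lt hax
      exact ⟨l + 1, satChain_succ_iff.2 ⟨x, hl, hxb⟩⟩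

theorem bddAbove_setOf_satChain [Finite Q] (a b : Q) : BddAbove {l : ℕ | SatChain a b l} := by
  have := Fintype.ofFinite Q
  refine ⟨Fintype.card Q, ?_⟩
  rintro l ⟨c, -, -, hc⟩
  have hmono : StrictMono c := Fin.strictMono_iff_lt_succ.2 fun i => (hc i).lt
  have := Fintype.card_le_of_injective c hmono.injective
  rw [Fintype.card_fin] at this
  omega

theorem satChain_chainRank [Finite Q] {a b : Q} (h : a ≤ b) : SatChain a b (chainRank a b) :=
  Nat.sSup_mem (exists_satChain h) (bddAbove_setOf_satChain a b)

theorem satChain_chainDist [Finite Q] {a b : Q} (h : a ≤ b) : SatChain a b (chainDist a b) :=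
  Nat.sInf_mem (exists_satChain h)

theorem SatChain.le_chainRank [Finite Q] {a b : Q} {l : ℕ} (h : SatChain a b l) :
    l ≤ chainRank a b :=
  le_csSup (bddAbove_setOf_satChain a b) h

theorem SatChain.chainDist_le {a b : Q} {l : ℕ} (h : SatChain a b l) : chainDist a b ≤ l :=
  Nat.sInf_le h

theorem chainDist_self (a : Q) : chainDist a a = 0 :=
  Nat.le_zero.1 (satChain_zero_iff.2 rfl : SatChain a a 0).chainDist_le

theorem chainRank_self [Finite Q] (a : Q) : chainRank a a = 0 := by
  generalize hl : chainRank a a = l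
  have h := satChain_chainRank (le_refl a)
  rw [hl] at h
  cases l with
  | zero => rfl
  | succ l =>
    obtain ⟨x, hx, hxa⟩ := satChain_succ_iff.1 h
    exact absurd hxa.lt hx.le.not_gt

theorem chainRank_add_one_le [Finite Q] {a b c : Q} (hab : a ≤ b) (hbc : b ⋖ c) :
    chainRank a b + 1 ≤ chainRank a c :=
  ((satChain_chainRank hab).trans hbc.satChain).le_chainRank

theorem chainDist_le_add_one [Finite Q] {a b c : Q} (hab : a ⋖ b) (hbc : b ≤ c) :
    chainDist a c ≤ chainDist b c + 1 :=
  (hab.satChain.trans (satChain_chainDist hbc)).chainDist_le.trans_eq (add_comm _ _)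

theorem IsGrading.sub_eq_of_satChain {A : Set Q} (hA : OrderConvex A) {ψ : A → ℤ}
    (hψ : IsGrading A ψ) {a b : A} {l : ℕ} (h : SatChain (a : Q) b l) : ψ a - ψ b = l := by
  induction l generalizing b with
  | zero => rw [Subtype.ext (satChain_zero_iff.1 h)]; simp
  | succ l ih =>
    obtain ⟨x, hx, hxb⟩ := satChain_succ_iff.1 h
    lift x to A using hA a x b hx.le hxb.le a.2 b.2
    have hcov := hψ x b ⟨hxb.lt, fun c hc => hxb.2 hc⟩
    have := ih hx
    push_cast
    omega

/-- `CoverWalk A x y n` says that `y` can be reached from `x` inside `A` along covering relations,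
traversed in either direction, with `n` equal to the number of upward steps minus the number of
downward steps. -/
inductive CoverWalk (A : Set Q) (x : Q) : Q → ℤ → Prop
  | nil : CoverWalk A x x 0
  | up {y z : Q} {n : ℤ} : CoverWalk A x y n → z ∈ A → y ⋖ z → CoverWalk A x z (n + 1)
  | down {y z : Q} {n : ℤ} : CoverWalk A x y n → z ∈ A → z ⋖ y → CoverWalk A x z (n - 1)

theorem CoverWalk.mem {A : Set Q} {x y : Q} {n : ℤ} (h : CoverWalk A x y n) (hx : x ∈ A) :
    y ∈ A := by
  cases h <;> assumption

theorem CoverWalk.closed_sub {A : Set Q} {x y : Q} {m n : ℤ} (hx : x ∈ A)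
    (hm : CoverWalk A x y m) (hn : CoverWalk A x y n) : CoverWalk A x x (n - m) := by
  induction hm generalizing n with
  | nil => simpa using hn
  | up h _ hyz ih => simpa [sub_sub, add_comm] using ih (hn.down (h.mem hx) hyz)
  | @down y z m h _ hzy ih =>
    have := ih (hn.up (h.mem hx) hzy)
    rwa [show n - (m - 1) = n + 1 - m by ring]

theorem CoverWalk.append_up {A : Set Q} (hA : OrderConvex A) {x y z : Q} {n : ℤ} {l : ℕ}
    (h : CoverWalk A x y n) (hy : y ∈ A) (hz : z ∈ A) (hl : SatChain y z l) :
    CoverWalk A x z (n + l) := by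
  induction l generalizing z with
  | zero => rw [← satChain_zero_iff.1 hl]; simpa using h
  | succ l ih =>
    obtain ⟨c, hc, hcz⟩ := satChain_succ_iff.1 hl
    have := (ih (hA y c z hc.le hcz.le hy hz) hc).up hz hcz
    simpa [add_assoc] using this

theorem CoverWalk.append_down {A : Set Q} (hA : OrderConvex A) {x y z : Q} {n : ℤ} {l : ℕ}
    (h : CoverWalk A x y n) (hy : y ∈ A) (hz : z ∈ A) (hl : SatChain z y l) :
    CoverWalk A x z (n - l) := by
  induction l generalizing y n with
  | zero => rw [satChain_zero_iff.1 hl]; simpa using h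
  | succ l ih =>
    obtain ⟨c, hc, hcy⟩ := satChain_succ_iff.1 hl
    have hcA := hA z c y hc.le hcy.le hz hy
    have := ih (h.down hcA hcy) hcA hc
    simpa [sub_sub, add_comm] using this

theorem ConnSubset.exists_coverWalk [Finite Q] {A : Set Q} (hconn : ConnSubset A)
    (hA : OrderConvex A) {x y : Q} (hx : x ∈ A) (hy : y ∈ A) : ∃ n, CoverWalk A x y n := by
  have h := hconn x hx y hy
  clear hy
  induction h with
  | refl => exact ⟨0, .nil⟩
  | tail _ h ih =>
    obtain ⟨n, hn⟩ := ih
    obtain ⟨hp, hq, hle | hle⟩ := h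
    · obtain ⟨l, hl⟩ := exists_satChain hle
      exact ⟨_, hn.append_up hA hp hq hl⟩
    · obtain ⟨l, hl⟩ := exists_satChain hle
      exact ⟨_, hn.append_down hA hp hq hl⟩

theorem isGradedPoset_of_closed_coverWalk [Finite Q] {A : Set Q} (hconn : ConnSubset A)
    (hA : OrderConvex A) {x : Q} (hx : x ∈ A) (h : ∀ n, CoverWalk A x x n → n ≤ 0) :
    IsGradedPoset A := by
  choose f hf using fun y : A => hconn.exists_coverWalk hA hx y.2
  refine ⟨fun y => -f y, fun y z hyz => ?_⟩
  have hcov : (y : Q) ⋖ z :=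
    ⟨hyz.lt, fun c hyc hcz =>
      hyz.2 (c := ⟨c, hA y c z hyc.le hcz.le y.2 z.2⟩) hyc hcz⟩
  have hup := (hf y).up z.2 hcov
  have h₁ := h _ ((hf z).closed_sub hx hup)
  have h₂ := h _ (hup.closed_sub hx (hf z))
  dsimp only
  omega

/-- `ZigzagPath A x y n` says that there is a zigzag `x = a₀ < b₀ > a₁ < b₁ > ⋯ > a_k = y` in `A`
whose sum of ranks minus sum of distances is `n`. -/
def ZigzagPath (A : Set Q) (x y : Q) (n : ℤ) : Prop :=
  ∃ (k : ℕ) (a b : ℕ → Q), a 0 = x ∧ a k = y ∧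
    (∀ i < k, a i ∈ A ∧ b i ∈ A ∧ a i < b i ∧ a (i + 1) < b i) ∧
    n = ∑ i ∈ Finset.range k, ((chainRank (a i) (b i) : ℤ) - chainDist (a (i + 1)) (b i))

theorem ZigzagPath.refl (A : Set Q) (x : Q) : ZigzagPath A x x 0 :=
  ⟨0, fun _ => x, fun _ => x, rfl, rfl, by simp, by simp⟩

theorem ZigzagPath.snoc {A : Set Q} {x y z b : Q} {n : ℤ} (h : ZigzagPath A x y n)
    (hy : y ∈ A) (hb : b ∈ A) (hyb : y < b) (hzb : z < b) :
    ZigzagPath A x z (n + (chainRank y b - chainDist z b)) := by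
  obtain ⟨k, a, c, rfl, rfl, hlt, rfl⟩ := h
  refine ⟨k + 1, fun i => if i ≤ k then a i else z, fun i => if i < k then c i else b,
    by simp, by simp, fun i hi => ?_, ?_⟩
  · rcases (Nat.lt_succ_iff.1 hi).eq_or_lt with rfl | hik
    · simp [hy, hb, hyb, hzb]
    · simpa [hik, hik.le] using hlt i hik
  · rw [Finset.sum_range_succ]
    congr 1
    · refine Finset.sum_congr rfl fun i hi => ?_
      have hik := Finset.mem_range.1 hi
      simp [hik, hik.le]
    · simp

theorem CoverWalk.exists_zigzagPath [Finite Q] {A : Set Q} {x y : Q} {n : ℤ}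
    (hx : Minimal (· ∈ A) x) (h : CoverWalk A x y n) :
    ∃ (z b : Q) (m : ℤ), ZigzagPath A x z m ∧ z ∈ A ∧ b ∈ A ∧ y ≤ b ∧
      (z < b ∨ z = b ∧ b = x) ∧ n ≤ m + (chainRank z b - chainDist y b) := by
  induction h with
  | nil =>
    exact ⟨x, x, 0, .refl A x, hx.1, hx.1, le_rfl, .inr ⟨rfl, rfl⟩,
      by simp [chainRank_self, chainDist_self]⟩
  | @up y y' n h hy' hyy' ih =>
    obtain ⟨z, b, m, hz, hzA, hbA, hyb, hzb, hn⟩ := ih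
    have hyA := h.mem hx.1
    rcases hyb.eq_or_lt with rfl | hyb
    · have hzy : z ≤ y := hzb.elim le_of_lt fun h => h.1.le
      refine ⟨z, y', m, hz, hzA, hy', le_rfl, .inl (hzy.trans_lt hyy'.lt), ?_⟩
      have := chainRank_add_one_le hzy hyy'
      rw [chainDist_self] at hn ⊢
      omega
    · rcases hzb with hzb | ⟨rfl, rfl⟩
      · refine ⟨y, y', _, hz.snoc hzA hbA hzb hyb, hyA, hy', le_rfl, .inl hyy'.lt, ?_⟩
        have := chainRank_add_one_le le_rfl hyy'
        rw [chainDist_self]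
        omega
      · exact absurd hyb (hx.not_lt hyA)
  | @down y y' n h hy' hyy' ih =>
    obtain ⟨z, b, m, hz, hzA, hbA, hyb, hzb, hn⟩ := ih
    refine ⟨z, b, m, hz, hzA, hbA, hyy'.le.trans hyb, hzb, ?_⟩
    have := chainDist_le_add_one hyy' hyb
    omega

theorem CoverWalk.exists_closed_zigzagPath [Finite Q] {A : Set Q} {x : Q} {n : ℤ}
    (hx : Minimal (· ∈ A) x) (h : CoverWalk A x x n) : ∃ m, n ≤ m ∧ ZigzagPath A x x m := by
  obtain ⟨z, b, m, hz, hzA, hbA, hxb, hzb | ⟨rfl, rfl⟩, hn⟩ := h.exists_zigzagPath hx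
  · have hlt : x < b := hxb.lt_of_ne fun he => hx.not_lt hzA (he ▸ hzb)
    exact ⟨_, hn, hz.snoc hzA hbA hzb hlt⟩
  · rw [chainRank_self, chainDist_self] at hn
    exact ⟨m, by simpa using hn, hz⟩

theorem ZigzagPath.exists_cyclic {A : Set Q} {x : Q} {n : ℤ} (h : ZigzagPath A x x n)
    (hn : 0 < n) :
    ∃ (u : ℕ) (a b : Fin (u + 1) → Q),
      (∀ i, a i ∈ A) ∧ (∀ i, b i ∈ A) ∧ (∀ i, a i < b i) ∧ (∀ i, a (i + 1) < b i) ∧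
      (∑ i, chainRank (a i) (b i)) > ∑ i, chainDist (a (i + 1)) (b i) := by
  obtain ⟨k, a, b, h0, hk, hlt, rfl⟩ := h
  cases k with
  | zero => simp at hn
  | succ u =>
    have hsucc (i : Fin (u + 1)) : a (i + 1 : Fin (u + 1)) = a (i + 1 : ℕ) := by
      induction i using Fin.lastCases with
      | last => simp [h0, hk]
      | cast i => simp
    refine ⟨u, fun i => a i, fun i => b i, fun i => (hlt i i.2).1, fun i => (hlt i i.2).2.1,
      fun i => (hlt i i.2).2.2.1, fun i => (hsucc i).trans_lt (hlt i i.2).2.2.2, ?_⟩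
    rw [Finset.sum_range, Finset.sum_sub_distrib, sub_pos] at hn
    simp only [hsucc]
    exact_mod_cast hn

theorem IsGradedPoset.sum_chainRank_eq [Finite Q] {A : Set Q} (hA : OrderConvex A)
    (h : IsGradedPoset A) {u : ℕ} {a b : Fin (u + 1) → Q} (ha : ∀ i, a i ∈ A)
    (hb : ∀ i, b i ∈ A) (hab : ∀ i, a i < b i) (hab' : ∀ i, a (i + 1) < b i) :
    ∑ i, chainRank (a i) (b i) = ∑ i, chainDist (a (i + 1)) (b i) := by
  obtain ⟨ψ, hψ⟩ := h
  lift a to Fin (u + 1) → A using ha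
  lift b to Fin (u + 1) → A using hb
  have hrank i : (chainRank (a i : Q) (b i) : ℤ) = ψ (a i) - ψ (b i) :=
    (hψ.sub_eq_of_satChain hA (satChain_chainRank (hab i).le)).symm
  have hdist i : (chainDist (a (i + 1) : Q) (b i) : ℤ) = ψ (a (i + 1)) - ψ (b i) :=
    (hψ.sub_eq_of_satChain hA (satChain_chainDist (hab' i).le)).symm
  zify
  simp only [hrank, hdist, Finset.sum_sub_distrib]
  exact congrArg (· - _) (Equiv.sum_comp (Equiv.addRight 1) fun i => ψ (a i)).symm

end ZigzagGrading

/-- A complete subset `A` of `P̄` is not graded iff there are `u ≥ 1`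
elements `a_1 < b_1 > a_2 < b_2 > ⋯ > a_u < b_u > a_1` of `A` with
`∑ rank(a_i, b_i) > dist(a_2, b_1) + ⋯ + dist(a_u, b_{u-1}) + dist(a_1, b_u)`.
(The zigzag is indexed cyclically by `Fin (u+1)`, so it has `u + 1 ≥ 1` pairs.) -/
theorem not_graded_iff_zigzag
    (P : Type) [Fintype P] [PartialOrder P]
    (A : Set (WithBot (WithTop P))) (hA : CompleteSubset A) :
    ¬ IsGradedPoset ↥A ↔
      ∃ (u : ℕ) (a b : Fin (u + 1) → WithBot (WithTop P)),
        (∀ i, a i ∈ A) ∧ (∀ i, b i ∈ A) ∧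
        (∀ i, a i < b i) ∧ (∀ i, a (i + 1) < b i) ∧
        (∑ i, chainRank (a i) (b i)) > ∑ i, chainDist (a (i + 1)) (b i) := by
  obtain ⟨hne, hconn, hconv⟩ := hA
  constructor
  · intro hgr
    obtain ⟨x, hx⟩ := A.toFinite.exists_minimal hne
    obtain ⟨n, hn, hpos⟩ : ∃ n, CoverWalk A x x n ∧ 0 < n := by
      by_contra! hcon
      exact hgr (isGradedPoset_of_closed_coverWalk hconn hconv hx.1 hcon)
    obtain ⟨m, hnm, hm⟩ := hn.exists_closed_zigzagPath hx
    exact hm.exists_cyclic (hpos.trans_le hnm)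
  · rintro ⟨u, a, b, ha, hb, hab, hab', hlt⟩ hgr
    exact hlt.ne' (hgr.sum_chainRank_eq hconv ha hb hab hab')
end

section
/- Assume n ≥ 4, so that the primitive ray generators of σ are exactly the vectors R^i_j, L_i and S. Fix distinct indices l ≠ m and let F = σ^∨ ∩ S^⊥ ∩ L_l^⊥ ∩ L_m^⊥, a face of σ^∨. Then F[1] contains a point of ℤ^N if and only if Σ_{i ≠ l,m} k_i = 3; moreover, when Σ_{i ≠ l,m} k_i = 3, the point q given by q_0 = k_l + k_m, q^l_1 = k_m, q^m_1 = k_l, and q^i_j = 1 for all other coordinates, is an integral point of F[1]. -/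
set_option synthInstance.maxHeartbeats 1000000
set_option maxHeartbeats 1000000

noncomputable section

variable {α : Type} [Fintype α]

/-- pairing of an integer vector with a real vector -/
def ipair (u : α → ℤ) (x : α → ℝ) : ℝ := ∑ j, (u j : ℝ) * x j

/-- pairing of two integer vectors -/
def zpair (u m : α → ℤ) : ℤ := ∑ j, u j * m j

/-- pairing of two real vectors -/
def rpair (u x : α → ℝ) : ℝ := ∑ j, u j * x j

/-- the real vector associated to an integer vector -/
def toReal (m : α → ℤ) : α → ℝ := fun j => (m j : ℝ)

variable {ι : Type} [Fintype ι]

/-- the cone `σ` generated by the integer vectors `u i` -/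
def genCone (u : ι → α → ℤ) : Set (α → ℝ) :=
  {x | ∃ c : ι → ℝ, (∀ i, 0 ≤ c i) ∧ x = ∑ i, c i • toReal (u i)}

/-- the dual cone `σ^∨` of the cone generated by the `u i` -/
def dualCone (u : ι → α → ℤ) : Set (α → ℝ) := {x | ∀ i, 0 ≤ ipair (u i) x}

/-- the polyhedron `P_K` -/
def PK (u : ι → α → ℤ) : Set (α → ℝ) := {x | ∀ i, 1 ≤ ipair (u i) x}

/-- the polyhedron `P_{-K}` -/
def PmK (u : ι → α → ℤ) : Set (α → ℝ) := {x | ∀ i, (-1 : ℝ) ≤ ipair (u i) x}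

/-- the cone generated by `u` is pointed -/
def IsPointed (u : ι → α → ℤ) : Prop := ∀ x ∈ genCone u, -x ∈ genCone u → x = 0

/-- an integer vector is primitive if the gcd of its coordinates is a unit -/
def Primitive (m : α → ℤ) : Prop := IsUnit (Finset.univ.gcd m)

/-- the ray spanned by an integer vector -/
def ray (v : α → ℤ) : Set (α → ℝ) := {x | ∃ t : ℝ, 0 ≤ t ∧ x = t • toReal v}

/-- `u` lists exactly the primitive ray generators of the rational pointed cone `σ` that it
generates: `σ` is pointed, each `u i` is primitive, and each `u i` spans an extreme ray of `σ`. -/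
def IsRaySetup (u : ι → α → ℤ) : Prop :=
  IsPointed u ∧ (∀ i, Primitive (u i)) ∧ ∀ i, IsExtreme ℝ (genCone u) (ray (u i))

variable (k : Type) [Field k]

/-- the monomial `χ^m` in the Laurent polynomial ring `k[ℤ^α]` -/
def mono (m : α → ℤ) : AddMonoidAlgebra k (α → ℤ) := AddMonoidAlgebra.single m 1

/-- the toric ring `R = k[σ^∨ ∩ M]`, the subalgebra of `k[ℤ^α]` spanned by the monomials
`χ^m` with `m ∈ σ^∨ ∩ M` -/
def toricRing (u : ι → α → ℤ) : Subalgebra k (AddMonoidAlgebra k (α → ℤ)) :=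
  Algebra.adjoin k {f | ∃ m : α → ℤ, toReal m ∈ dualCone u ∧ f = mono k m}

/-- the canonical module `ω`, the `R`-submodule of `k[ℤ^α]` spanned by the monomials `χ^m`
with `m ∈ P_K ∩ M` -/
def canMod (u : ι → α → ℤ) : Submodule ↥(toricRing k u) (AddMonoidAlgebra k (α → ℤ)) :=
  Submodule.span ↥(toricRing k u) {f | ∃ m : α → ℤ, toReal m ∈ PK u ∧ f = mono k m}

/-- the trace ideal `tr(ω)` of the canonical module -/
def traceIdeal (u : ι → α → ℤ) : Ideal ↥(toricRing k u) :=
  Ideal.span {r | ∃ (φ : ↥(canMod k u) →ₗ[↥(toricRing k u)] ↥(toricRing k u))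
    (x : ↥(canMod k u)), φ x = r}

/-- a face `F` of the dual cone `σ^∨`: the intersection of `σ^∨` with the hyperplane orthogonal
to a supporting vector `w ∈ σ` -/
def IsFaceOfDual (u : ι → α → ℤ) (F : Set (α → ℝ)) : Prop :=
  ∃ w ∈ genCone u, F = {x ∈ dualCone u | rpair w x = 0}

/-- the graded prime ideal `p_F` associated to a face `F` of `σ^∨`, generated by the monomials
`χ^m` with `m ∈ (σ^∨ ∩ M) \ F` -/
def facePrime (u : ι → α → ℤ) (F : Set (α → ℝ)) : Ideal ↥(toricRing k u) :=
  Ideal.span {r | ∃ m : α → ℤ, toReal m ∈ dualCone u ∧ toReal m ∉ F ∧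
    (r : AddMonoidAlgebra k (α → ℤ)) = mono k m}

/-- `F[1]`: the intersection of all facet-defining hyperplanes containing `F`, translated by one
lattice length into the interior of `σ^∨` -/
def faceShift (u : ι → α → ℤ) (F : Set (α → ℝ)) : Set (α → ℝ) :=
  {x | ∀ i, (∀ y ∈ F, ipair (u i) y = 0) → ipair (u i) x = 1}


/-- coordinate index set for `ℝ^N`, `N = 1 + k_1 + ⋯ + k_n`: `none` is the `q_0`-coordinate,
`some ⟨i, j⟩` is the `q^i_j`-coordinate -/
abbrev SegIdx (n : ℕ) (kk : Fin n → ℕ) : Type := Option ((i : Fin n) × Fin (kk i))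

/-- index set for the generators `R^i_j`, `L_i`, `S` of the cone `σ` -/
abbrev SegGen (n : ℕ) (kk : Fin n → ℕ) : Type := ((i : Fin n) × Fin (kk i)) ⊕ (Fin n ⊕ Unit)

/-- the vector `R^i_j = e^i_j` -/
def segR {n : ℕ} {kk : Fin n → ℕ} (p : (i : Fin n) × Fin (kk i)) : SegIdx n kk → ℤ :=
  fun x => if x = some p then 1 else 0

/-- the vector `L_i = e_0 - ∑_j e^i_j` -/
def segL {n : ℕ} {kk : Fin n → ℕ} (i : Fin n) : SegIdx n kk → ℤ :=
  fun x => match x with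
    | none => 1
    | some p => if p.1 = i then -1 else 0

/-- the vector `S = ∑_{i,j} e^i_j - 2 e_0` -/
def segS {n : ℕ} {kk : Fin n → ℕ} : SegIdx n kk → ℤ :=
  fun x => match x with
    | none => -2
    | some _ => 1

/-- the generators `R^i_j`, `L_i`, `S` of the cone `σ` dual to the cone `σ^∨` of the affine
chart of the first secant variety of the Segre variety -/
def segGens (n : ℕ) (kk : Fin n → ℕ) : SegGen n kk → SegIdx n kk → ℤ
  | Sum.inl p => segR p
  | Sum.inr (Sum.inl i) => segL i
  | Sum.inr (Sum.inr _) => segS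

/-- `v` is a primitive ray generator of the cone generated by the family `u` -/
def IsPrimRayGen {α ι : Type} [Fintype α] [Fintype ι] (u : ι → α → ℤ) (v : α → ℤ) : Prop :=
  Primitive v ∧ toReal v ∈ genCone u ∧ IsExtreme ℝ (genCone u) (ray v)

variable (k : Type) [Field k]

/-- the canonical module of the toric ring `k[σ^∨ ∩ ℤ^N]`: spanned by the monomials `χ^m`
with `⟨u_ρ, m⟩ ≥ 1` for all primitive ray generators `u_ρ` of `σ` -/
def segOmega (n : ℕ) (kk : Fin n → ℕ) :
    Submodule ↥(toricRing k (segGens n kk)) (AddMonoidAlgebra k (SegIdx n kk → ℤ)) :=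
  Submodule.span ↥(toricRing k (segGens n kk))
    {f | ∃ m : SegIdx n kk → ℤ,
      (∀ v : SegIdx n kk → ℤ, IsPrimRayGen (segGens n kk) v → 1 ≤ zpair v m) ∧
      f = mono k m}

/-- the trace ideal `tr(ω)` for the secant toric ring -/
def segTrace (n : ℕ) (kk : Fin n → ℕ) : Ideal ↥(toricRing k (segGens n kk)) :=
  Ideal.span {r | ∃ (φ : ↥(segOmega k n kk) →ₗ[↥(toricRing k (segGens n kk))]
      ↥(toricRing k (segGens n kk))) (x : ↥(segOmega k n kk)), φ x = r}

end

lemma ipair_segR {n : ℕ} {kk : Fin n → ℕ} (p : (i : Fin n) × Fin (kk i))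
    (x : SegIdx n kk → ℝ) : ipair (segR p) x = x (some p) := by
  simp [ipair, segR]

lemma ipair_segL {n : ℕ} {kk : Fin n → ℕ} (i : Fin n) (x : SegIdx n kk → ℝ) :
    ipair (segL i) x = x none - ∑ j, x (some ⟨i, j⟩) := by
  have h : ∀ i' : Fin n, ∑ j : Fin (kk i'), (((if i' = i then -1 else 0 : ℤ)) : ℝ) *
      x (some ⟨i', j⟩) = if i' = i then -∑ j, x (some ⟨i', j⟩) else 0 := by
    intro i'
    split_ifs <;> simp
  simp only [ipair, segL, Fintype.sum_option, Fintype.sum_sigma, h, Finset.sum_ite_eq',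
    Finset.mem_univ, if_true]
  push_cast
  ring

lemma ipair_segS {n : ℕ} {kk : Fin n → ℕ} (x : SegIdx n kk → ℝ) :
    ipair segS x = ∑ i, ∑ j, x (some ⟨i, j⟩) - 2 * x none := by
  simp only [ipair, segS, Fintype.sum_option, Fintype.sum_sigma]
  push_cast
  simp only [one_mul]
  ring

lemma sum_eq_add_add_sum_sdiff_pair {ι M : Type*} [Fintype ι] [DecidableEq ι] [AddCommMonoid M]
    {l m : ι} (hlm : l ≠ m) (f : ι → M) :
    ∑ i, f i = f l + f m + ∑ i ∈ Finset.univ \ {l, m}, f i := by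
  rw [← Finset.sum_pair hlm, add_comm, Finset.sum_sdiff (Finset.subset_univ _)]

/-- the face `σ^∨ ∩ S^⊥ ∩ L_l^⊥ ∩ L_m^⊥` of the dual cone -/
def secantFace {n : ℕ} (kk : Fin n → ℕ) (l m : Fin n) : Set (SegIdx n kk → ℝ) :=
  {x ∈ dualCone (segGens n kk) |
    ipair segS x = 0 ∧ ipair (segL l) x = 0 ∧ ipair (segL m) x = 0}

/-- the generator `e_0 + e^l_a + e^m_b` of the face `secantFace kk l m` -/
def secantFaceVertex {n : ℕ} {kk : Fin n → ℕ} {l m : Fin n} (a : Fin (kk l)) (b : Fin (kk m)) :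
    SegIdx n kk → ℝ
  | none => 1
  | some p => (if p = ⟨l, a⟩ then 1 else 0) + (if p = ⟨m, b⟩ then 1 else 0)

lemma sum_ite_sigma_eq {n : ℕ} {kk : Fin n → ℕ} {l : Fin n} (a : Fin (kk l)) (i : Fin n) :
    ∑ j : Fin (kk i), (if (⟨i, j⟩ : (i : Fin n) × Fin (kk i)) = ⟨l, a⟩ then (1 : ℝ) else 0) =
      if i = l then 1 else 0 := by
  by_cases h : i = l
  · subst h
    simp
  · simp [h]

lemma sum_secantFaceVertex {n : ℕ} {kk : Fin n → ℕ} {l m : Fin n} (a : Fin (kk l))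
    (b : Fin (kk m)) (i : Fin n) :
    ∑ j, secantFaceVertex a b (some ⟨i, j⟩) =
      (if i = l then 1 else 0) + (if i = m then 1 else 0) := by
  simp only [secantFaceVertex, Finset.sum_add_distrib, sum_ite_sigma_eq]

lemma secantFaceVertex_mem {n : ℕ} {kk : Fin n → ℕ} {l m : Fin n} (hlm : l ≠ m)
    (a : Fin (kk l)) (b : Fin (kk m)) : secantFaceVertex a b ∈ secantFace kk l m := by
  have hS : ipair segS (secantFaceVertex a b) = 0 := by
    simp only [ipair_segS, sum_secantFaceVertex, Finset.sum_add_distrib, Finset.sum_ite_eq',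
      Finset.mem_univ, if_true]
    norm_num [secantFaceVertex]
  have hL (i : Fin n) : ipair (segL i) (secantFaceVertex a b) =
      1 - ((if i = l then 1 else 0) + (if i = m then 1 else 0)) := by
    rw [ipair_segL, sum_secantFaceVertex]
    rfl
  refine ⟨?_, hS, ?_, ?_⟩
  · rintro (p | i | _)
    · simp only [segGens, ipair_segR, secantFaceVertex]
      positivity
    · simp only [segGens, hL]
      split_ifs with h₁ h₂
      · exact absurd (h₁.symm.trans h₂) hlm
      all_goals norm_num
    · exact hS.ge
  · simp [hL, hlm]
  · simp [hL, hlm.symm]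

lemma apply_eq_zero_of_mem_secantFace {n : ℕ} {kk : Fin n → ℕ} {l m : Fin n} (hlm : l ≠ m)
    {x : SegIdx n kk → ℝ} (hx : x ∈ secantFace kk l m) (p : (i : Fin n) × Fin (kk i))
    (hl : p.1 ≠ l) (hm : p.1 ≠ m) : x (some p) = 0 := by
  obtain ⟨hd, hS, hLl, hLm⟩ := hx
  have hR (q) : 0 ≤ x (some q) := by simpa [segGens, ipair_segR] using hd (Sum.inl q)
  rw [ipair_segS, sum_eq_add_add_sum_sdiff_pair hlm] at hS
  rw [ipair_segL] at hLl hLm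
  have h0 : ∑ i ∈ Finset.univ \ {l, m}, ∑ j, x (some ⟨i, j⟩) = 0 := by linarith
  rw [Finset.sum_eq_zero_iff_of_nonneg fun i _ => Finset.sum_nonneg fun j _ => hR _] at h0
  have h1 := h0 p.1 (by simp [hl, hm])
  rw [Finset.sum_eq_zero_iff_of_nonneg fun j _ => hR _] at h1
  exact h1 p.2 (Finset.mem_univ _)

lemma mem_faceShift_secantFace_iff {n : ℕ} {kk : Fin n → ℕ} (hk : ∀ i, 1 ≤ kk i) {l m : Fin n}
    (hlm : l ≠ m) (x : SegIdx n kk → ℝ) :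
    x ∈ faceShift (segGens n kk) (secantFace kk l m) ↔
      (∀ p : (i : Fin n) × Fin (kk i), p.1 ≠ l → p.1 ≠ m → x (some p) = 1) ∧
      x none - ∑ j, x (some ⟨l, j⟩) = 1 ∧ x none - ∑ j, x (some ⟨m, j⟩) = 1 ∧
      ∑ i, ∑ j, x (some ⟨i, j⟩) - 2 * x none = 1 := by
  have vertex_mem (a : Fin (kk l)) (b : Fin (kk m)) := secantFaceVertex_mem hlm a b
  constructor
  · intro h
    refine ⟨fun p hl hm => ?_, ?_, ?_, ?_⟩
    · rw [← ipair_segR p x]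
      refine h (Sum.inl p) fun y hy => ?_
      rw [segGens, ipair_segR]
      exact apply_eq_zero_of_mem_secantFace hlm hy p hl hm
    · rw [← ipair_segL]
      exact h (Sum.inr (Sum.inl l)) fun y hy => hy.2.2.1
    · rw [← ipair_segL]
      exact h (Sum.inr (Sum.inl m)) fun y hy => hy.2.2.2
    · rw [← ipair_segS]
      exact h (Sum.inr (Sum.inr ())) fun y hy => hy.2.1
  · rintro ⟨hR, hl, hm, hS⟩ (⟨i, j⟩ | i | _) h
    · rw [segGens, ipair_segR]
      refine hR _ ?_ ?_
      · rintro rfl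
        have := h _ (vertex_mem j ⟨0, hk m⟩)
        simp [segGens, ipair_segR, secantFaceVertex, hlm] at this
      · rintro rfl
        have := h _ (vertex_mem ⟨0, hk l⟩ j)
        simp [segGens, ipair_segR, secantFaceVertex, hlm.symm] at this
    · rw [segGens, ipair_segL]
      by_cases hil : i = l
      · rwa [hil]
      by_cases him : i = m
      · rwa [him]
      have := h _ (vertex_mem ⟨0, hk l⟩ ⟨0, hk m⟩)
      rw [segGens, ipair_segL, sum_secantFaceVertex] at this
      simp [secantFaceVertex, hil, him] at this
    · rwa [segGens, ipair_segS]

lemma sum_ite_val_eq_zero {k : ℕ} (hk : 1 ≤ k) (c : ℝ) :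
    ∑ j : Fin k, (if j.val = 0 then c else 1) = c + k - 1 := by
  obtain ⟨k, rfl⟩ := Nat.exists_eq_add_of_le' hk
  simp [Fin.sum_univ_succ]
  ring

/-- Assume `n ≥ 4`, so that the primitive ray generators of `σ` are exactly
the vectors `R^i_j`, `L_i`, `S`.  For distinct `l ≠ m`, let
`F = σ^∨ ∩ S^⊥ ∩ L_l^⊥ ∩ L_m^⊥`, a face of `σ^∨`.  Then `F[1]` contains a point of `ℤ^N`
iff `∑_{i ≠ l,m} k_i = 3`; moreover, in that case the point `q` with `q_0 = k_l + k_m`,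
`q^l_1 = k_m`, `q^m_1 = k_l` and all other coordinates `1` is an integral point of `F[1]`. -/
theorem secant_face_shift_lattice_point
    (n : ℕ) (hn : 4 ≤ n) (kk : Fin n → ℕ) (hk : ∀ i, 1 ≤ kk i) (hmono : Monotone kk)
    (l m : Fin n) (hlm : l ≠ m) :
    ((∃ q : SegIdx n kk → ℤ, toReal q ∈ faceShift (segGens n kk)
        {x ∈ dualCone (segGens n kk) |
          ipair segS x = 0 ∧ ipair (segL l) x = 0 ∧ ipair (segL m) x = 0}) ↔
      (∑ i ∈ Finset.univ \ ({l, m} : Finset (Fin n)), kk i) = 3) ∧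
    ((∑ i ∈ Finset.univ \ ({l, m} : Finset (Fin n)), kk i) = 3 →
      toReal (fun x : SegIdx n kk => match x with
        | none => (kk l : ℤ) + kk m
        | some p => if p.1 = l ∧ p.2.val = 0 then (kk m : ℤ)
            else if p.1 = m ∧ p.2.val = 0 then (kk l : ℤ) else 1) ∈
        faceShift (segGens n kk)
          {x ∈ dualCone (segGens n kk) |
            ipair segS x = 0 ∧ ipair (segL l) x = 0 ∧ ipair (segL m) x = 0}) := by
  change ((∃ q : SegIdx n kk → ℤ, toReal q ∈ faceShift _ (secantFace kk l m)) ↔ _) ∧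
    (_ → _ ∈ faceShift _ (secantFace kk l m))
  simp only [mem_faceShift_secantFace_iff hk hlm]
  have sum_rest {x : SegIdx n kk → ℝ}
      (hR : ∀ p : (i : Fin n) × Fin (kk i), p.1 ≠ l → p.1 ≠ m → x (some p) = 1) :
      ∑ i ∈ Finset.univ \ {l, m}, ∑ j, x (some ⟨i, j⟩) =
        ((∑ i ∈ Finset.univ \ ({l, m} : Finset (Fin n)), kk i : ℕ) : ℝ) := by
    rw [Nat.cast_sum]
    refine Finset.sum_congr rfl fun i hi => ?_
    simp only [Finset.mem_sdiff, Finset.mem_univ, true_and, Finset.mem_insert,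
      Finset.mem_singleton, not_or] at hi
    simp [hR ⟨i, _⟩ hi.1 hi.2]
  refine (fun hpoint => ⟨⟨?only_if, fun h => ⟨_, hpoint h⟩⟩, hpoint⟩) ?point
  case only_if =>
    rintro ⟨q, hR, hl, hm, hS⟩
    rw [sum_eq_add_add_sum_sdiff_pair hlm, sum_rest hR] at hS
    have : ((∑ i ∈ Finset.univ \ ({l, m} : Finset (Fin n)), kk i : ℕ) : ℝ) = 3 := by linarith
    exact_mod_cast this
  case point =>
    intro h3
    set q : SegIdx n kk → ℤ := fun x => match x with
        | none => (kk l : ℤ) + kk m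
        | some p => if p.1 = l ∧ p.2.val = 0 then (kk m : ℤ)
            else if p.1 = m ∧ p.2.val = 0 then (kk l : ℤ) else 1 with hq
    have h0 : toReal q none = kk l + kk m := by simp [toReal, hq]
    have hR : ∀ p : (i : Fin n) × Fin (kk i), p.1 ≠ l → p.1 ≠ m → toReal q (some p) = 1 := by
      intro p hl hm
      simp [toReal, hq, hl, hm]
    have hl : ∑ j, toReal q (some ⟨l, j⟩) = kk m + kk l - 1 := by
      rw [← sum_ite_val_eq_zero (hk l)]
      simp [toReal, hq, hlm]
    have hm : ∑ j, toReal q (some ⟨m, j⟩) = kk l + kk m - 1 := by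
      rw [← sum_ite_val_eq_zero (hk m)]
      simp [toReal, hq, hlm.symm]
    refine ⟨hR, ?_, ?_, ?_⟩
    · rw [h0, hl]
      ring
    · rw [h0, hm]
      ring
    · rw [sum_eq_add_add_sum_sdiff_pair hlm, sum_rest hR, h3, h0, hl, hm]
      push_cast
      ring
end
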